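/- Let 0 < κ ≤ 1/12 and Λ > 0. There exist C_Λ > 0 and λ₀ ∈ (0,1) (depending only on κ and Λ) such that for all 0 < λ ≤ λ₀, with η := λ^{2+κ}, for every α ∈ [0, 6] with |||α||| ≥ Λ and every u ∈ 𝕋³: ∫_{𝕋³}∫_{𝕋³}∫_{𝕋³} dp dq dr / ( |α − ω̄(p) − iη| · |α − ω̄(q) − iη| · |α − ω̄(r) − iη| · |α − ω̄(p − q + r − u) − iη| ) ≤ C_Λ λ^{−4κ} |log η|^{14}. -/

import Mathlib

open MeasureTheory Filter Topology

noncomputable section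

/-- The torus `𝕋³ = [-1/2, 1/2]³` realized as a box in `ℝ³`. -/
def T3 : Set (Fin 3 → ℝ) := Set.pi Set.univ fun _ => Set.Icc (-(1/2) : ℝ) (1/2)

/-- The lattice dispersion relation `e(p) = ∑_j (1 - cos(2π p_j))`. -/
def edisp (p : Fin 3 → ℝ) : ℝ := ∑ j, (1 - Real.cos (2 * Real.pi * p j))

/-- `Θ_ε(α) = ∫_{𝕋³} dq / (α - e(q) + iε)`. -/
def ThetaEps (ε α : ℝ) : ℂ := ∫ q in T3, ((α : ℂ) - (edisp q : ℂ) + (ε : ℂ) * Complex.I)⁻¹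

/-- `Θ` is the limit of `Θ_ε` as `ε → 0⁺`. -/
def IsThetaLimit (Θ : ℝ → ℂ) : Prop :=
  ∀ α : ℝ, Tendsto (fun ε => ThetaEps ε α) (𝓝[>] (0 : ℝ)) (𝓝 (Θ α))

/-- The renormalized dispersion `ω(p) = e(p) + λ² Θ(e(p))`. -/
def omegaR (Θ : ℝ → ℂ) (lam : ℝ) (p : Fin 3 → ℝ) : ℂ :=
  (edisp p : ℂ) + (lam : ℂ) ^ 2 * Θ (edisp p)

/-- A function on `𝕋³`, i.e. a `ℤ³`-periodic function on `ℝ³`. -/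
def ZPeriodic (g : (Fin 3 → ℝ) → ℂ) : Prop :=
  ∀ (p : Fin 3 → ℝ) (n : Fin 3 → ℤ), g (p + fun j => (n j : ℝ)) = g p

/-- The `C¹` norm `‖g‖_∞ + ‖∇g‖_∞`. -/
def C1Norm (g : (Fin 3 → ℝ) → ℂ) : ℝ :=
  (⨆ p : Fin 3 → ℝ, ‖g p‖) + ⨆ p : Fin 3 → ℝ, ‖fderiv ℝ g p‖

/-- `|||α||| = min {|α|, |α-2|, |α-3|, |α-4|, |α-6|}`. -/
def anorm (a : ℝ) : ℝ := min (min (min |a| |a - 2|) (min |a - 3| |a - 4|)) |a - 6|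

/-- Distance between two points of the circle `ℝ/ℤ`. -/
def cdist (x y : ℝ) : ℝ := |x - y - (round (x - y) : ℝ)|

/-- `|||q||| = η + min {dist(q, γ) : γ a critical point of e}` (torus distance);
the critical points are exactly the points with all coordinates in `{0, 1/2}` mod `1`,
and minimizing over them coordinatewise gives the formula below. -/
def tnorm (η : ℝ) (q : Fin 3 → ℝ) : ℝ :=
  η + Real.sqrt (∑ j, (min (cdist (q j) 0) (cdist (q j) (1/2))) ^ 2)

/-- `|∇e(q)|`, the Euclidean length of the gradient of the dispersion relation. -/
def gradNorm (q : Fin 3 → ℝ) : ℝ := Real.sqrt (∑ j, (2 * Real.pi * Real.sin (2 * Real.pi * q j)) ^ 2)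


open scoped ENNReal

/-- The unit interval centred at the origin. -/
abbrev UI : Set ℝ := Set.Icc (-(1/2) : ℝ) (1/2)

/-- Reciprocal with values in extended nonnegative reals. -/
def ri (x : ℝ) : ℝ≥0∞ := (ENNReal.ofReal x)⁻¹

lemma ri_anti {x y : ℝ} (h : x ≤ y) : ri y ≤ ri x :=
  ENNReal.inv_le_inv.2 (ENNReal.ofReal_le_ofReal h)

lemma ri_eq {x : ℝ} (h : 0 < x) : ri x = ENNReal.ofReal (1 / x) := by
  rw [ri, one_div, ENNReal.ofReal_inv_of_pos h]

lemma ri_mul {x y : ℝ} (hx : 0 ≤ x) : ri (x * y) = ri x * ri y := by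
  rw [ri, ENNReal.ofReal_mul hx, ENNReal.mul_inv] <;> simp [ri]

lemma ri_min (x y : ℝ) : ri (min x y) ≤ ri x + ri y := by
  rcases le_total x y with h | h
  · rw [min_eq_left h]; exact le_self_add
  · rw [min_eq_right h]; exact le_add_self

lemma ri_ne_top {x : ℝ} (h : 0 < x) : ri x ≠ ∞ := by
  rw [ri_eq h]; exact ENNReal.ofReal_ne_top

lemma ri_measurable : Measurable ri := ENNReal.measurable_ofReal.inv

lemma measurable_ri_comp {α : Type*} [MeasurableSpace α] {f : α → ℝ} (hf : Measurable f) :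
    Measurable (fun x => ri (f x)) := ri_measurable.comp hf

lemma lint_shift {H : ℝ → ℝ≥0∞} (hH : Function.Periodic H 1) (c : ℝ) :
    ∫⁻ x in UI, H (x + c) = ∫⁻ x in UI, H x := by
  have key : ∀ t : ℝ, ∫⁻ x in Set.Ioc t (t+1), H x = ∫⁻ x in Set.Ioc (-(1/2):ℝ) (-(1/2)+1), H x := by
    intro t
    refine IsAddFundamentalDomain.setLIntegral_eq (G := AddSubgroup.zmultiples (1:ℝ))
      (isAddFundamentalDomain_Ioc one_pos t volume) (isAddFundamentalDomain_Ioc one_pos _ volume) H ?_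
    rintro ⟨g, hg⟩ x
    obtain ⟨n, rfl⟩ := AddSubgroup.mem_zmultiples_iff.1 hg
    have := hH.int_mul n x
    simp only [AddSubgroup.mk_vadd, vadd_eq_add]
    rw [add_comm]; simpa using this
  have e1 : ∀ G : ℝ → ℝ≥0∞, ∫⁻ x in UI, G x = ∫⁻ x in Set.Ioc (-(1/2):ℝ) (-(1/2)+1), G x := by
    intro G
    rw [show (-(1/2):ℝ)+1 = 1/2 by norm_num]
    exact setLIntegral_congr Ioc_ae_eq_Icc.symm
  rw [e1, e1, ← key (-(1/2)+c)]
  have hm : MeasurePreserving (fun x : ℝ => x + c) volume volume := measurePreserving_add_right volume c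
  have he : MeasurableEmbedding (fun x : ℝ => x + c) := measurableEmbedding_addRight c
  have := hm.setLIntegral_comp_preimage_emb he H (Set.Ioc (-(1/2)+c) (-(1/2)+c+1))
  rw [← this]
  congr 2
  ext x; simp only [Set.mem_Ioc, Set.mem_preimage]
  constructor <;> rintro ⟨h1, h2⟩ <;> constructor <;> linarith

lemma abs_sin_periodic : Function.Periodic (fun x : ℝ => |Real.sin (Real.pi * x)|) 1 := by
  intro x
  simp [mul_add, Real.sin_add_pi]

lemma abs_sin_ge {x : ℝ} (hx : x ∈ UI) : 2 * |x| ≤ |Real.sin (Real.pi * x)| := by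
  have hp := Real.pi_pos
  have h1 : |x| ≤ 1/2 := abs_le.2 hx
  have := @Real.mul_abs_le_abs_sin (Real.pi * x) (by rw [abs_mul, abs_of_pos hp]; nlinarith)
  rw [abs_mul, abs_of_pos hp] at this
  calc 2 * |x| = 2 / Real.pi * (Real.pi * |x|) := by field_simp
    _ ≤ _ := this

/-- Reduction of integrals of functions of `|sin(πx+φ)|` to functions of `|2x|`. -/
lemma lint_sin_le {g : ℝ → ℝ≥0∞} (hg : Antitone g) (φ : ℝ) :
    ∫⁻ x in UI, g |Real.sin (Real.pi * x + φ)| ≤ ∫⁻ x in UI, g (2 * |x|) := by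
  have hper : Function.Periodic (fun x : ℝ => g |Real.sin (Real.pi * x)|) 1 := by
    intro x; have := abs_sin_periodic x; simp only at this ⊢; rw [this]
  have h1 := lint_shift hper (φ / Real.pi)
  have h2 : ∀ x, Real.pi * (x + φ / Real.pi) = Real.pi * x + φ := by
    intro x; have := Real.pi_ne_zero; field_simp
  simp only [h2] at h1
  rw [h1]
  refine setLIntegral_mono' measurableSet_Icc ?_
  intro x hx
  exact hg (abs_sin_ge hx)

lemma lint_even {g : ℝ → ℝ≥0∞} : ∫⁻ x in UI, g |x| = 2 * ∫⁻ x in Set.Ioc (0:ℝ) (1/2), g x := by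
  have hu : UI = Set.Icc (-(1/2):ℝ) 0 ∪ Set.Ioc 0 (1/2) := by
    rw [Set.Icc_union_Ioc_eq_Icc] <;> norm_num
  rw [hu, lintegral_union measurableSet_Ioc, two_mul]
  · congr 1
    · have hm : MeasurePreserving (fun x : ℝ => -x) volume volume := Measure.measurePreserving_neg volume
      have he : MeasurableEmbedding (fun x : ℝ => -x) := (MeasurableEquiv.neg ℝ).measurableEmbedding
      have := hm.setLIntegral_comp_preimage_emb he g (Set.Icc 0 (1/2))
      rw [setLIntegral_congr (Ioc_ae_eq_Icc (a := (0:ℝ)) (b := 1/2)), ← this]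
      have hs : (fun x : ℝ => -x) ⁻¹' (Set.Icc 0 (1/2)) = Set.Icc (-(1/2):ℝ) 0 := by
        ext x; simp only [Set.mem_Icc, Set.mem_preimage]
        constructor <;> rintro ⟨h1, h2⟩ <;> constructor <;> linarith
      rw [hs]
      refine setLIntegral_congr_fun measurableSet_Icc ?_
      intro x hx; simp only; rw [abs_of_nonpos hx.2]
    · refine setLIntegral_congr_fun measurableSet_Ioc ?_
      intro x hx; simp only; rw [abs_of_pos hx.1]
  · rw [Set.disjoint_left]; intro x hx hx'; exact absurd hx.2 (not_le.2 hx'.1)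

lemma lint_inv_add {a b η : ℝ} (ha : 0 < a) (hb : 0 ≤ b) (hη : 0 < η) :
    ∫⁻ x in Set.Ioc (0:ℝ) b, ri (a * x + η) = ENNReal.ofReal (1 / a * Real.log ((a * b + η) / η)) := by
  have hpos : ∀ x ∈ Set.Icc 0 b, 0 < a * x + η := fun x hx => by
    have := mul_nonneg ha.le hx.1; linarith
  have hd : ∀ x ∈ Set.uIcc 0 b, HasDerivAt (fun x => 1 / a * Real.log (a * x + η)) (1 / (a * x + η)) x := by
    intro x hx
    rw [Set.uIcc_of_le hb] at hx
    have h1 : HasDerivAt (fun x => a * x + η) a x := by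
      simpa using ((hasDerivAt_id x).const_mul a).add_const η
    have := (h1.log (hpos x hx).ne').const_mul (1 / a)
    have h3 := (hpos x hx).ne'
    rw [show 1 / (a * x + η) = 1 / a * (a / (a * x + η)) by
      rw [← mul_div_assoc, one_div_mul_cancel ha.ne']]
    exact this
  have hc : ContinuousOn (fun x => 1 / (a * x + η)) (Set.uIcc 0 b) := by
    apply ContinuousOn.div continuousOn_const (by fun_prop)
    intro x hx; rw [Set.uIcc_of_le hb] at hx; exact (hpos x hx).ne'
  have hi := intervalIntegral.integral_eq_sub_of_hasDerivAt hd hc.intervalIntegrable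
  have hii : IntegrableOn (fun x => 1 / (a * x + η)) (Set.Ioc 0 b) := by
    have := hc.intervalIntegrable (μ := volume)
    rwa [intervalIntegrable_iff_integrableOn_Ioc_of_le hb] at this
  rw [setLIntegral_congr_fun (g := fun x => ENNReal.ofReal (1 / (a * x + η))) measurableSet_Ioc
    (fun x hx => ri_eq (hpos x ⟨hx.1.le, hx.2⟩))]
  rw [← ofReal_integral_eq_lintegral_ofReal hii]
  · rw [← intervalIntegral.integral_of_le hb, hi]
    congr 1
    have h1 := hpos b ⟨hb, le_rfl⟩
    rw [Real.log_div h1.ne' hη.ne']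
    simp; ring
  · filter_upwards [ae_restrict_mem measurableSet_Ioc] with x hx
    exact (div_pos one_pos (hpos x ⟨hx.1.le, hx.2⟩)).le

/-- Basic logarithmic integral. -/
lemma lint_log {η : ℝ} (h0 : 0 < η) (h1 : η ≤ 1/2) (φ : ℝ) :
    ∫⁻ x in UI, ri (|Real.sin (Real.pi * x + φ)| + η) ≤ ENNReal.ofReal (2 * -Real.log η) := by
  refine (lint_sin_le (g := fun y => ri (y + η)) (fun x y h => ri_anti (by linarith)) φ).trans ?_
  rw [lint_even (g := fun x => ri (2 * x + η)), lint_inv_add two_pos (by norm_num) h0,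
    show (2:ℝ≥0∞) = ENNReal.ofReal 2 by simp, ← ENNReal.ofReal_mul (by norm_num)]
  apply ENNReal.ofReal_le_ofReal
  rw [Real.log_div (by positivity) h0.ne']
  have : Real.log (2 * (1/2) + η) ≤ - Real.log η := by
    rw [← Real.log_inv]
    apply Real.log_le_log (by positivity)
    rw [le_inv_comm₀ (by positivity) h0, inv_eq_one_div, le_div_iff₀ (by positivity)]
    nlinarith
  linarith

/-- Integrability of negative powers of the sine. -/
lemma lint_pow {s : ℝ} (hs0 : 0 ≤ s) (hs : s < 1) : ∃ C : ℝ, 0 < C ∧ ∀ φ : ℝ,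
    ∫⁻ x in UI, (ri |Real.sin (Real.pi * x + φ)|) ^ s ≤ ENNReal.ofReal C := by
  refine ⟨2 * ((1/2) ^ (-s+1) / (-s+1)), by have : 0 < -s+1 := by linarith
                                            positivity, fun φ => ?_⟩
  refine (lint_sin_le (g := fun y => (ri y) ^ s)
    (fun x y h => ENNReal.rpow_le_rpow (ri_anti h) hs0) φ).trans ?_
  have hle : ∫⁻ x in UI, (ri (2 * |x|)) ^ s ≤ ∫⁻ x in UI, (ri |x|) ^ s := by
    refine lintegral_mono fun x => ENNReal.rpow_le_rpow (ri_anti ?_) hs0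
    have := abs_nonneg x; linarith
  refine hle.trans ?_
  rw [lint_even (g := fun x => (ri x) ^ s), ENNReal.ofReal_mul (by norm_num)]
  simp only [ENNReal.ofReal_ofNat]
  gcongr
  have hii : IntegrableOn (fun x : ℝ => x ^ (-s)) (Set.Ioc 0 (1/2)) := by
    have := intervalIntegral.intervalIntegrable_rpow' (a := 0) (b := 1/2) (r := -s) (by linarith)
    rwa [intervalIntegrable_iff_integrableOn_Ioc_of_le (by norm_num)] at this
  have hi := integral_rpow (a := 0) (b := 1/2) (r := -s) (Or.inl (by linarith))
  rw [setLIntegral_congr_fun (g := fun x => ENNReal.ofReal (x ^ (-s))) measurableSet_Ioc]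
  · rw [← ofReal_integral_eq_lintegral_ofReal hii, ← intervalIntegral.integral_of_le (by norm_num), hi]
    · rw [Real.zero_rpow (by linarith), sub_zero]
    · filter_upwards [ae_restrict_mem measurableSet_Ioc] with x hx
      exact Real.rpow_nonneg hx.1.le _
  · intro x hx
    simp only
    rw [ri_eq hx.1, ENNReal.ofReal_rpow_of_pos (by have := hx.1; positivity), one_div, Real.inv_rpow hx.1.le,
      Real.rpow_neg hx.1.le]

/-- `min (|sin(πx+φ)|, |sin(πx-φ)|)`. -/
def mm (φ x : ℝ) : ℝ := min |Real.sin (Real.pi * x + φ)| |Real.sin (Real.pi * x + -φ)|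

lemma mm_nonneg (φ x : ℝ) : 0 ≤ mm φ x := le_min (abs_nonneg _) (abs_nonneg _)

lemma mm_le_one (φ x : ℝ) : mm φ x ≤ 1 := (min_le_left _ _).trans (Real.abs_sin_le_one _)

lemma cos_gap (γ : ℝ) : ∃ φ : ℝ, ∀ x : ℝ,
    Real.sqrt |(|γ| - 1)| * mm φ x ≤ |γ - Real.cos (2 * Real.pi * x)| ∧
    mm φ x ^ 2 ≤ |γ - Real.cos (2 * Real.pi * x)| ∧
    |Real.sin (2 * Real.pi * x)| * mm φ x ≤ |γ - Real.cos (2 * Real.pi * x)| := by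
  -- algebraic core
  have core : ∀ (X Y m S D d : ℝ), 0 ≤ X → 0 ≤ Y → m = min X Y → S ≤ X + Y → 2 * X * Y ≤ D → 
      S * m ≤ D ∧ m ^ 2 ≤ D := by
    intro X Y m S D d hX hY hm hS hD
    rcases le_total X Y with h | h
    · rw [min_eq_left h] at hm; subst hm
      constructor <;> nlinarith
    · rw [min_eq_right h] at hm; subst hm
      constructor <;> nlinarith
  have hsin2 : ∀ y ψ : ℝ, |Real.sin (2 * y)| ≤ |Real.sin (y + ψ)| + |Real.sin (y + -ψ)| := by
    intro y ψ
    have : Real.sin (2 * y) = Real.sin (y + ψ) * Real.cos (y + -ψ) + Real.cos (y + ψ) * Real.sin (y + -ψ) := by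
      rw [← Real.sin_add]; ring_nf
    rw [this]
    refine (abs_add_le _ _).trans ?_
    rw [abs_mul, abs_mul]
    have h1 := Real.abs_cos_le_one (y + -ψ)
    have h2 := Real.abs_cos_le_one (y + ψ)
    have h3 := abs_nonneg (Real.sin (y + ψ))
    have h4 := abs_nonneg (Real.sin (y + -ψ))
    nlinarith
  have hsin2' : ∀ y ψ : ℝ, |Real.sin (2 * ψ)| ≤ |Real.sin (y + ψ)| + |Real.sin (y + -ψ)| := by
    intro y ψ
    have h := hsin2 ψ y
    rw [add_comm ψ y] at h
    rwa [show ψ + -y = -(y + -ψ) by ring, Real.sin_neg, abs_neg] at h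
  have hcos : ∀ y ψ : ℝ, |Real.cos (2 * ψ) - Real.cos (2 * y)| =
      2 * |Real.sin (y + ψ)| * |Real.sin (y + -ψ)| := by
    intro y ψ
    have : Real.cos (2 * ψ) - Real.cos (2 * y) = 2 * (Real.sin (y + ψ) * Real.sin (y + -ψ)) := by
      rw [Real.cos_sub_cos]
      rw [show (2 * ψ + 2 * y) / 2 = y + ψ by ring, show (2 * ψ - 2 * y) / 2 = -(y + -ψ) by ring, Real.sin_neg]
      ring
    rw [this, abs_mul, abs_mul, abs_two]; ring
  by_cases h1 : |γ| ≤ 1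
  · obtain ⟨l1, l2⟩ := abs_le.1 h1
    refine ⟨Real.arccos γ / 2, fun x => ?_⟩
    set ψ := Real.arccos γ / 2 with hψ
    have e1 : Real.cos (2 * ψ) = γ := by
      rw [hψ, mul_div_cancel₀ _ two_ne_zero, Real.cos_arccos l1 l2]
    have e2 := hcos (Real.pi * x) ψ
    rw [e1, ← mul_assoc] at e2
    have hs := hsin2 (Real.pi * x) ψ
    rw [← mul_assoc] at hs
    have hs' : Real.sqrt |(|γ| - 1)| ≤ |Real.sin (2 * ψ)| := by
      apply Real.sqrt_le_iff.2 ⟨abs_nonneg _, ?_⟩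
      rw [sq_abs, Real.sin_sq, e1, abs_of_nonpos (by linarith), ← sq_abs γ]
      nlinarith [abs_nonneg γ]
    rw [e2]
    have c1 := core _ _ (mm ψ x) _ _ 0 (abs_nonneg _) (abs_nonneg _) rfl hs le_rfl
    have c2 := core _ _ (mm ψ x) _ _ 0 (abs_nonneg _) (abs_nonneg _) rfl
      (hs'.trans (hsin2' (Real.pi * x) ψ)) le_rfl
    exact ⟨c2.1, c1.2, c1.1⟩
  · push Not at h1
    have fin : ∀ ψ : ℝ, ∀ x : ℝ, |Real.sin (Real.pi * x + ψ)| = |Real.sin (Real.pi * x + -ψ)| →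
        |γ - Real.cos (2 * Real.pi * x)| = (|γ| - 1) + |Real.cos (2 * ψ) - Real.cos (2 * (Real.pi * x))| →
        Real.sqrt |(|γ| - 1)| * mm ψ x ≤ |γ - Real.cos (2 * Real.pi * x)| ∧
        mm ψ x ^ 2 ≤ |γ - Real.cos (2 * Real.pi * x)| ∧
        |Real.sin (2 * Real.pi * x)| * mm ψ x ≤ |γ - Real.cos (2 * Real.pi * x)| := by
      intro ψ x hE hG
      have hs := hsin2 (Real.pi * x) ψ
      rw [← mul_assoc] at hs
      have hmm : mm ψ x = |Real.sin (Real.pi * x + ψ)| := by rw [mm, ← hE, min_self]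
      rw [hG, hcos, ← hE, hmm]
      rw [← hE] at hs
      have hn := abs_nonneg (Real.sin (Real.pi * x + ψ))
      have hp : 0 < |γ| - 1 := by linarith
      rw [abs_of_pos hp]
      have hq := Real.sq_sqrt hp.le
      have hq' := Real.sqrt_nonneg (|γ| - 1)
      generalize |Real.sin (Real.pi * x + ψ)| = m at *
      generalize Real.sqrt (|γ| - 1) = s at *
      refine ⟨?_, ?_, ?_⟩
      · nlinarith [sq_nonneg (s - m), sq_nonneg m]
      · nlinarith [sq_nonneg (s - m), sq_nonneg m]
      · nlinarith [sq_nonneg (s - m), sq_nonneg m]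
    rcases lt_abs.1 h1 with h | h
    · refine ⟨0, fun x => fin 0 x (by simp) ?_⟩
      have := Real.cos_le_one (2 * (Real.pi * x))
      rw [mul_assoc, abs_of_nonneg (by linarith), abs_of_pos (by linarith : 0 < γ)]
      rw [abs_of_nonneg (by simpa using this)]
      simp
    · refine ⟨Real.pi / 2, fun x => fin _ x ?_ ?_⟩
      · rw [Real.sin_add_pi_div_two, ← sub_eq_add_neg, Real.sin_sub_pi_div_two, abs_neg]
      · have := Real.neg_one_le_cos (2 * (Real.pi * x))
        rw [mul_assoc, abs_of_neg (by linarith), abs_of_neg (by linarith : γ < 0)]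
        rw [mul_div_cancel₀ _ two_ne_zero, Real.cos_pi, abs_of_nonpos (by linarith)]
        ring

lemma ri_mm_add (φ x η : ℝ) : ri (mm φ x + η) ≤
    ri (|Real.sin (Real.pi * x + φ)| + η) + ri (|Real.sin (Real.pi * x + -φ)| + η) := by
  rw [mm, ← min_add_add_right]; exact ri_min _ _

lemma lint_mm {η : ℝ} (h0 : 0 < η) (h1 : η ≤ 1/2) (φ : ℝ) :
    ∫⁻ x in UI, ri (mm φ x + η) ≤ ENNReal.ofReal (4 * -Real.log η) := by
  refine (lintegral_mono fun x => ri_mm_add φ x η).trans ?_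
  rw [lintegral_add_left (measurable_ri_comp (by fun_prop))]
  refine (add_le_add (lint_log h0 h1 _) (lint_log h0 h1 _)).trans ?_
  have : 0 ≤ -Real.log η := by
    have := Real.log_nonpos h0.le (by linarith); linarith
  rw [← ENNReal.ofReal_add (by linarith) (by linarith)]
  apply ENNReal.ofReal_le_ofReal; linarith

/-- One dimensional propagator integral. -/
lemma lint_cos {η γ : ℝ} (h0 : 0 < η) (h1 : η ≤ 1/2) (hγ : |γ| ≤ 5) :
    ∫⁻ x in UI, ri (|γ - Real.cos (2 * Real.pi * x)| + η) ≤
      ENNReal.ofReal (16 * -Real.log η) * ri (Real.sqrt (|(|γ| - 1)| + η)) := by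
  obtain ⟨φ, hφ⟩ := cos_gap γ
  set δ := |(|γ| - 1)| with hδ
  have hδ0 : 0 ≤ δ := abs_nonneg _
  have hδ4 : δ ≤ 4 := by
    rw [hδ, abs_le]; constructor <;> [have := abs_nonneg γ; skip] <;> linarith
  have hs0 : 0 ≤ Real.sqrt (δ + η) := Real.sqrt_nonneg _
  have key : ∀ x, (1/4) * (Real.sqrt (δ + η) * (mm φ x + η)) ≤ |γ - Real.cos (2 * Real.pi * x)| + η := by
    intro x
    obtain ⟨a, b, -⟩ := hφ x
    have hm := mm_nonneg φ x
    have hsq : Real.sqrt (δ + η) ^ 2 = δ + η := Real.sq_sqrt (by linarith)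
    have hle : Real.sqrt (δ + η) ≤ Real.sqrt δ + Real.sqrt η := by
      apply Real.sqrt_le_iff.2 ⟨by positivity, ?_⟩
      nlinarith [Real.sq_sqrt hδ0, Real.sq_sqrt h0.le, Real.sqrt_nonneg δ, Real.sqrt_nonneg η,
        mul_nonneg (Real.sqrt_nonneg δ) (Real.sqrt_nonneg η)]
    have hη' : Real.sqrt η ^ 2 = η := Real.sq_sqrt h0.le
    have hle3 : Real.sqrt (δ + η) ≤ 3 := Real.sqrt_le_iff.2 ⟨by norm_num, by linarith⟩
    have hsm : Real.sqrt η * mm φ x ≤ (η + mm φ x ^ 2) / 2 := by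
      nlinarith [sq_nonneg (Real.sqrt η - mm φ x)]
    have : Real.sqrt (δ + η) * mm φ x ≤ Real.sqrt δ * mm φ x + Real.sqrt η * mm φ x := by nlinarith
    nlinarith
  calc _ ≤ ∫⁻ x in UI, (ri (1/4) * ri (Real.sqrt (δ + η))) * ri (mm φ x + η) := by
        refine lintegral_mono fun x => ?_
        refine (ri_anti (key x)).trans ?_
        rw [ri_mul (by norm_num), ri_mul hs0, mul_assoc]
    _ = (ri (1/4) * ri (Real.sqrt (δ + η))) * ∫⁻ x in UI, ri (mm φ x + η) := by
        rw [lintegral_const_mul]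
        apply measurable_ri_comp; unfold mm; fun_prop
    _ ≤ (ri (1/4) * ri (Real.sqrt (δ + η))) * ENNReal.ofReal (4 * -Real.log η) := by
        gcongr; exact lint_mm h0 h1 φ
    _ = _ := by
        rw [ri_eq (x := 1/4) (by norm_num)]
        rw [show (16 * -Real.log η) = (1 / (1/4)) * (4 * -Real.log η) by ring,
          ENNReal.ofReal_mul (p := 1 / (1/4)) (by norm_num)]
        ring

/-- Propagator integral weighted by the velocity. -/
lemma lint_cos_sin {η : ℝ} (γ : ℝ) (h0 : 0 < η) (h1 : η ≤ 1/2) :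
    ∫⁻ x in UI, ENNReal.ofReal |Real.sin (2 * Real.pi * x)| * ri (|γ - Real.cos (2 * Real.pi * x)| + η) ≤
      ENNReal.ofReal (4 * -Real.log η) := by
  obtain ⟨φ, hφ⟩ := cos_gap γ
  refine le_trans (lintegral_mono fun x => ?_) (lint_mm h0 h1 φ)
  obtain ⟨-, -, c⟩ := hφ x
  have hs := Real.abs_sin_le_one (2 * Real.pi * x)
  have hs0 := abs_nonneg (Real.sin (2 * Real.pi * x))
  have hm := mm_nonneg φ x
  have hc : |Real.sin (2 * Real.pi * x)| * (mm φ x + η) ≤ |γ - Real.cos (2 * Real.pi * x)| + η := by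
    nlinarith
  have hp : 0 < |γ - Real.cos (2 * Real.pi * x)| + η := by positivity
  rw [ri_eq hp, ri_eq (by positivity), ← ENNReal.ofReal_mul hs0]
  apply ENNReal.ofReal_le_ofReal
  rw [mul_one_div, div_le_div_iff₀ hp (by positivity)]
  linarith

lemma cos_ge_mm (x : ℝ) : mm (Real.pi / 4) x ≤ |Real.cos (2 * Real.pi * x)| := by
  have h : Real.cos (2 * Real.pi * x) = -(2 * Real.sin (Real.pi * x + Real.pi / 4) * Real.sin (Real.pi * x + -(Real.pi / 4))) := by
    have := Real.cos_sub_cos (2 * Real.pi * x) (Real.pi / 2)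
    rw [Real.cos_pi_div_two, sub_zero] at this
    rw [this]; ring_nf
  have h2 : Real.sin (Real.pi * x + -(Real.pi / 4)) = - Real.cos (Real.pi * x + Real.pi / 4) := by
    rw [← Real.sin_sub_pi_div_two]; ring_nf
  rw [h, mm, h2, abs_neg, abs_neg, abs_mul, abs_mul, abs_two, abs_neg]
  have h3 := Real.sin_sq_add_cos_sq (Real.pi * x + Real.pi / 4)
  rw [← sq_abs, ← sq_abs (Real.cos _)] at h3
  have ha := abs_nonneg (Real.sin (Real.pi * x + Real.pi / 4))
  have hb := abs_nonneg (Real.cos (Real.pi * x + Real.pi / 4))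
  generalize |Real.sin (Real.pi * x + Real.pi / 4)| = a at *
  generalize |Real.cos (Real.pi * x + Real.pi / 4)| = b at *
  rcases le_total a b with h | h
  · rw [min_eq_left h]; nlinarith
  · rw [min_eq_right h]; nlinarith

lemma neglog_pos {η : ℝ} (h0 : 0 < η) (h1 : η ≤ 1/2) : 1/2 ≤ -Real.log η := by
  have h2 := Real.log_two_gt_d9
  have := Real.log_le_log h0 h1
  rw [one_div, Real.log_inv] at this
  linarith

lemma lint_inner_aux {η a b : ℝ} (h0 : 0 < η) (h1 : η ≤ 1/2) (ha : |a| ≤ 1) (hb : |b| ≤ |a|) :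
    ∫⁻ x in UI, ∫⁻ y in UI,
      ri (|a * Real.sin (2 * Real.pi * y) - b * Real.sin (2 * Real.pi * x)| + η) ≤
      ENNReal.ofReal (128 * (-Real.log η) ^ 2) * ri |a| := by
  have hL := neglog_pos h0 h1
  rcases eq_or_ne a 0 with rfl | ha0
  · have : ri |(0:ℝ)| = ∞ := by simp [ri]
    rw [this, ENNReal.mul_top]
    · exact le_top
    · rw [Ne, ENNReal.ofReal_eq_zero, not_le]; positivity
  have hapos : 0 < |a| := abs_pos.2 ha0
  have hin : ∀ x, ∫⁻ y in UI,
      ri (|a * Real.sin (2 * Real.pi * y) - b * Real.sin (2 * Real.pi * x)| + η) ≤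
      (ri |a| * (ENNReal.ofReal (16 * -Real.log η) * ri (1/2))) * ri (mm (Real.pi / 4) x + η) := by
    intro x
    set γ := b / a * Real.sin (2 * Real.pi * x) with hγ
    have hba : |b / a| ≤ 1 := by rw [abs_div]; exact div_le_one_of_le₀ hb hapos.le
    have hγs : |γ| ≤ |Real.sin (2 * Real.pi * x)| := by
      rw [hγ, abs_mul]
      have := abs_nonneg (Real.sin (2 * Real.pi * x)); nlinarith
    have hs1 := Real.abs_sin_le_one (2 * Real.pi * x)
    have hpt : ∀ y, ri (|a * Real.sin (2 * Real.pi * y) - b * Real.sin (2 * Real.pi * x)| + η) ≤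
        ri |a| * ri (|γ - Real.cos (2 * Real.pi * (y + -(1/4)))| + η) := by
      intro y
      rw [← ri_mul (abs_nonneg _)]
      apply ri_anti
      have e1 : Real.cos (2 * Real.pi * (y + -(1/4))) = Real.sin (2 * Real.pi * y) := by
        rw [← Real.cos_sub_pi_div_two]; ring_nf
      have e2 : a * Real.sin (2 * Real.pi * y) - b * Real.sin (2 * Real.pi * x) =
          a * (Real.sin (2 * Real.pi * y) - γ) := by rw [hγ]; field_simp
      rw [e1, e2, abs_mul, abs_sub_comm γ]
      nlinarith
    have hper : Function.Periodic (fun y => ri |a| * ri (|γ - Real.cos (2 * Real.pi * y)| + η)) 1 := by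
      intro y
      simp [mul_add, Real.cos_add_two_pi]
    calc _ ≤ ∫⁻ y in UI, ri |a| * ri (|γ - Real.cos (2 * Real.pi * (y + -(1/4)))| + η) :=
          lintegral_mono hpt
      _ = ∫⁻ y in UI, ri |a| * ri (|γ - Real.cos (2 * Real.pi * y)| + η) := lint_shift hper _
      _ = ri |a| * ∫⁻ y in UI, ri (|γ - Real.cos (2 * Real.pi * y)| + η) := by
          rw [lintegral_const_mul]; apply measurable_ri_comp; fun_prop
      _ ≤ ri |a| * (ENNReal.ofReal (16 * -Real.log η) * ri (Real.sqrt (|(|γ| - 1)| + η))) := by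
          gcongr; exact lint_cos h0 h1 (by linarith)
      _ ≤ ri |a| * (ENNReal.ofReal (16 * -Real.log η) * ri (1/2 * (mm (Real.pi/4) x + η))) := by
          gcongr; apply ri_anti
          apply Real.le_sqrt_of_sq_le
          rw [abs_of_nonpos (by linarith)]
          have hc := cos_ge_mm x
          have hm := mm_nonneg (Real.pi/4) x
          have hm1 := mm_le_one (Real.pi/4) x
          have hcs := Real.sin_sq_add_cos_sq (2 * Real.pi * x)
          rw [← sq_abs, ← sq_abs (Real.cos _)] at hcs
          have hm2 : mm (Real.pi/4) x ^ 2 ≤ |Real.cos (2 * Real.pi * x)| ^ 2 := by gcongr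
          have hss := abs_nonneg (Real.sin (2 * Real.pi * x))
          nlinarith
      _ = _ := by rw [ri_mul (x := 1/2) (by norm_num)]; ring
  refine (lintegral_mono hin).trans ?_
  rw [lintegral_const_mul _ (measurable_ri_comp (by unfold mm; fun_prop))]
  refine (mul_le_mul_right (lint_mm h0 h1 _) _).trans ?_
  rw [ri_eq (x := 1/2) (by norm_num)]
  rw [show (128 * (-Real.log η)^2) = (16 * -Real.log η) * (1 / (1/2)) * (4 * -Real.log η) by ring,
    ENNReal.ofReal_mul (p := (16 * -Real.log η) * (1 / (1/2))) (by positivity),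
    ENNReal.ofReal_mul (p := (16 * -Real.log η)) (by positivity)]
  apply le_of_eq; ring

/-- The unit square. -/
abbrev UI2 : Set (ℝ × ℝ) := UI ×ˢ UI

lemma lint_UI2 {F : ℝ × ℝ → ℝ≥0∞} (hF : Measurable F) :
    ∫⁻ a in UI2, F a = ∫⁻ x in UI, ∫⁻ y in UI, F (x, y) := by
  rw [Measure.volume_eq_prod, ← Measure.prod_restrict, lintegral_prod _ hF.aemeasurable]

lemma lint_UI2' {F : ℝ × ℝ → ℝ≥0∞} (hF : Measurable F) :
    ∫⁻ a in UI2, F a = ∫⁻ y in UI, ∫⁻ x in UI, F (x, y) := by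
  rw [Measure.volume_eq_prod, ← Measure.prod_restrict, lintegral_prod_symm _ hF.aemeasurable]

lemma lint_inner {η a b : ℝ} (h0 : 0 < η) (h1 : η ≤ 1/2) (ha : |a| ≤ 1) (hb : |b| ≤ 1) :
    ∫⁻ x in UI2, ri (|a * Real.sin (2 * Real.pi * x.2) - b * Real.sin (2 * Real.pi * x.1)| + η) ≤
      ENNReal.ofReal (128 * (-Real.log η) ^ 2) * ri (max |a| |b|) := by
  have hm : Measurable (fun x : ℝ × ℝ =>
      ri (|a * Real.sin (2 * Real.pi * x.2) - b * Real.sin (2 * Real.pi * x.1)| + η)) :=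
    measurable_ri_comp (by fun_prop)
  rcases le_total |b| |a| with h | h
  · rw [lint_UI2 hm, max_eq_left h]
    exact lint_inner_aux h0 h1 ha h
  · rw [lint_UI2' hm, max_eq_right h]
    refine le_trans (le_of_eq ?_) (lint_inner_aux h0 h1 hb h)
    simp only [abs_sub_comm]

lemma lint_sqrt_sin : ∃ C : ℝ, 0 < C ∧
    ∫⁻ x in UI, (ri |Real.sin (2 * Real.pi * x)|) ^ (1/2 : ℝ) ≤ ENNReal.ofReal C := by
  obtain ⟨C, hC, h⟩ := lint_pow (s := 1/2) (by norm_num) (by norm_num)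
  refine ⟨C + C, by positivity, ?_⟩
  have hpt : ∀ x, (ri |Real.sin (2 * Real.pi * x)|) ^ (1/2 : ℝ) ≤
      (ri |Real.sin (Real.pi * x + (Real.pi / 4 + -(Real.pi/4)))|) ^ (1/2 : ℝ) +
      (ri |Real.sin (Real.pi * x + (- (Real.pi / 4) + -(Real.pi/4)))|) ^ (1/2 : ℝ) := by
    intro x
    have h1 := cos_ge_mm (x + -(1/4))
    have h2 : Real.cos (2 * Real.pi * (x + -(1/4))) = Real.sin (2 * Real.pi * x) := by
      rw [← Real.cos_sub_pi_div_two]; ring_nf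
    rw [h2, mm] at h1
    refine (ENNReal.rpow_le_rpow (ri_anti h1) (by norm_num)).trans ?_
    have e1 : Real.pi * (x + -(1/4)) + Real.pi / 4 = Real.pi * x + (Real.pi / 4 + -(Real.pi/4)) := by ring
    have e2 : Real.pi * (x + -(1/4)) + -(Real.pi / 4) = Real.pi * x + (-(Real.pi / 4) + -(Real.pi/4)) := by ring
    rw [e1, e2]
    refine (ENNReal.rpow_le_rpow (ri_min _ _) (by norm_num)).trans ?_
    exact ENNReal.rpow_add_le_add_rpow _ _ (by norm_num) (by norm_num)
  refine (lintegral_mono hpt).trans ?_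
  rw [lintegral_add_left, ENNReal.ofReal_add hC.le hC.le]
  · exact add_le_add (h _) (h _)
  · exact (measurable_ri_comp (by fun_prop)).pow_const _

lemma lint_final {Λ : ℝ} (hΛ : 0 < Λ) : ∃ C : ℝ, 0 < C ∧ ∀ η b : ℝ, 0 < η → η ≤ 1/2 →
    Λ ≤ |b| → Λ ≤ |b - 2| → Λ ≤ |b + 2| →
    ∫⁻ a in UI2, ri (|b - Real.cos (2 * Real.pi * a.1) - Real.cos (2 * Real.pi * a.2)| + η) *
      ri (max |Real.sin (2 * Real.pi * a.1)| |Real.sin (2 * Real.pi * a.2)|) ≤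
      ENNReal.ofReal (C * -Real.log η) := by
  obtain ⟨C, hC, hCs⟩ := lint_sqrt_sin
  set ε := min 1 (Real.sqrt Λ / 2) with hε
  have hε0 : 0 < ε := lt_min one_pos (by have := Real.sqrt_pos.2 hΛ; positivity)
  have hε1 : ε ≤ 1 := min_le_left _ _
  have hεΛ : 2 * ε ^ 2 ≤ Λ / 2 := by
    have : ε ≤ Real.sqrt Λ / 2 := min_le_right _ _
    have h2 := Real.sq_sqrt hΛ.le
    nlinarith
  refine ⟨1 / (Λ/2) * C * C * 2 + 1 / ε * (1 / ε) * 8, by positivity, ?_⟩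
  intro η b h0 h1 hb0 hb2 hb2'
  have hL := neglog_pos h0 h1
  -- pointwise
  have hcosq : ∀ t : ℝ, |Real.sin t| < ε → |Real.cos t - 1| ≤ ε^2 ∨ |Real.cos t + 1| ≤ ε^2 := by
    intro t ht
    have h := Real.sin_sq_add_cos_sq t
    have hs : Real.sin t ^ 2 ≤ ε ^ 2 := by
      rw [← sq_abs]; have := abs_nonneg (Real.sin t); nlinarith
    have hc1 := Real.cos_le_one t
    have hc2 := Real.neg_one_le_cos t
    rcases le_total 0 (Real.cos t) with hc | hc
    · left; rw [abs_le]; constructor <;> nlinarith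
    · right; rw [abs_le]; constructor <;> nlinarith
  have hpt : ∀ a : ℝ × ℝ, ri (|b - Real.cos (2 * Real.pi * a.1) - Real.cos (2 * Real.pi * a.2)| + η) *
      ri (max |Real.sin (2 * Real.pi * a.1)| |Real.sin (2 * Real.pi * a.2)|) ≤
      ri (Λ/2) * ((ri |Real.sin (2 * Real.pi * a.1)|) ^ (1/2 : ℝ) * (ri |Real.sin (2 * Real.pi * a.2)|) ^ (1/2 : ℝ))
      + (ri ε * ri ε * (ENNReal.ofReal |Real.sin (2 * Real.pi * a.1)| *
          ri (|(b - Real.cos (2 * Real.pi * a.2)) - Real.cos (2 * Real.pi * a.1)| + η))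
      + ri ε * ri ε * (ENNReal.ofReal |Real.sin (2 * Real.pi * a.2)| *
          ri (|(b - Real.cos (2 * Real.pi * a.1)) - Real.cos (2 * Real.pi * a.2)| + η))) := by
    rintro ⟨x, y⟩
    simp only
    have hone : ∀ s : ℝ, ε ≤ s → 1 ≤ ri ε * ENNReal.ofReal s := by
      intro s hs
      rw [ri_eq hε0, ← ENNReal.ofReal_mul (by positivity), ENNReal.one_le_ofReal, one_div,
        inv_mul_eq_div, one_le_div hε0]
      exact hs
    by_cases hx : ε ≤ |Real.sin (2 * Real.pi * x)|
    · refine le_trans ?_ (le_add_left le_self_add)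
      have h2 : ri (max |Real.sin (2 * Real.pi * x)| |Real.sin (2 * Real.pi * y)|) ≤ ri ε :=
        ri_anti (hx.trans (le_max_left _ _))
      rw [show b - Real.cos (2 * Real.pi * y) - Real.cos (2 * Real.pi * x) = b - Real.cos (2 * Real.pi * x) - Real.cos (2 * Real.pi * y) by ring]
      set R := ri (|b - Real.cos (2 * Real.pi * x) - Real.cos (2 * Real.pi * y)| + η)
      calc R * _ ≤ R * ri ε := by gcongr
        _ = ri ε * 1 * R := by ring
        _ ≤ ri ε * (ri ε * ENNReal.ofReal |Real.sin (2 * Real.pi * x)|) * R := by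
            gcongr; exact hone _ hx
        _ = _ := by ring
    by_cases hy : ε ≤ |Real.sin (2 * Real.pi * y)|
    · refine le_trans ?_ (le_add_left le_add_self)
      have h2 : ri (max |Real.sin (2 * Real.pi * x)| |Real.sin (2 * Real.pi * y)|) ≤ ri ε :=
        ri_anti (hy.trans (le_max_right _ _))
      set R := ri (|b - Real.cos (2 * Real.pi * x) - Real.cos (2 * Real.pi * y)| + η)
      calc R * _ ≤ R * ri ε := by gcongr
        _ = ri ε * 1 * R := by ring
        _ ≤ ri ε * (ri ε * ENNReal.ofReal |Real.sin (2 * Real.pi * y)|) * R := by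
            gcongr; exact hone _ hy
        _ = _ := by ring
    · push Not at hx hy
      refine le_trans ?_ le_self_add
      gcongr
      · apply ri_anti
        have g1 := hcosq _ hx
        have g2 := hcosq _ hy
        have key : Λ - 2 * ε^2 ≤ |b - Real.cos (2 * Real.pi * x) - Real.cos (2 * Real.pi * y)| := by
          rcases g1 with g1 | g1 <;> rcases g2 with g2 | g2
          · have := abs_sub_abs_le_abs_sub (b - 2) ((Real.cos (2 * Real.pi * x) - 1) + (Real.cos (2 * Real.pi * y) - 1))
            have t := abs_add_le (Real.cos (2 * Real.pi * x) - 1) (Real.cos (2 * Real.pi * y) - 1)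
            rw [show b - 2 - ((Real.cos (2 * Real.pi * x) - 1) + (Real.cos (2 * Real.pi * y) - 1)) = b - Real.cos (2 * Real.pi * x) - Real.cos (2 * Real.pi * y) by ring] at this
            linarith
          · have := abs_sub_abs_le_abs_sub b ((Real.cos (2 * Real.pi * x) - 1) + (Real.cos (2 * Real.pi * y) + 1))
            have t := abs_add_le (Real.cos (2 * Real.pi * x) - 1) (Real.cos (2 * Real.pi * y) + 1)
            rw [show b - ((Real.cos (2 * Real.pi * x) - 1) + (Real.cos (2 * Real.pi * y) + 1)) = b - Real.cos (2 * Real.pi * x) - Real.cos (2 * Real.pi * y) by ring] at this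
            linarith
          · have := abs_sub_abs_le_abs_sub b ((Real.cos (2 * Real.pi * x) + 1) + (Real.cos (2 * Real.pi * y) - 1))
            have t := abs_add_le (Real.cos (2 * Real.pi * x) + 1) (Real.cos (2 * Real.pi * y) - 1)
            rw [show b - ((Real.cos (2 * Real.pi * x) + 1) + (Real.cos (2 * Real.pi * y) - 1)) = b - Real.cos (2 * Real.pi * x) - Real.cos (2 * Real.pi * y) by ring] at this
            linarith
          · have := abs_sub_abs_le_abs_sub (b + 2) ((Real.cos (2 * Real.pi * x) + 1) + (Real.cos (2 * Real.pi * y) + 1))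
            have t := abs_add_le (Real.cos (2 * Real.pi * x) + 1) (Real.cos (2 * Real.pi * y) + 1)
            rw [show b + 2 - ((Real.cos (2 * Real.pi * x) + 1) + (Real.cos (2 * Real.pi * y) + 1)) = b - Real.cos (2 * Real.pi * x) - Real.cos (2 * Real.pi * y) by ring] at this
            linarith
        linarith
      · set p := max |Real.sin (2 * Real.pi * x)| |Real.sin (2 * Real.pi * y)| with hp
        calc ri p = (ri p) ^ (1/2:ℝ) * (ri p) ^ (1/2:ℝ) := by
              rw [← ENNReal.rpow_add_of_nonneg _ _ (by norm_num) (by norm_num)]; norm_num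
          _ ≤ _ := by
              gcongr
              · exact ri_anti (le_max_left _ _)
              · exact ri_anti (le_max_right _ _)
  have ms : Measurable (fun x : ℝ => (ri |Real.sin (2 * Real.pi * x)|) ^ (1/2 : ℝ)) :=
    (measurable_ri_comp (by fun_prop)).pow_const _
  have m1 : Measurable (fun a : ℝ × ℝ => ri (Λ/2) * ((ri |Real.sin (2 * Real.pi * a.1)|) ^ (1/2 : ℝ) * (ri |Real.sin (2 * Real.pi * a.2)|) ^ (1/2 : ℝ))) := by
    exact ((ms.comp measurable_fst).mul (ms.comp measurable_snd)).const_mul _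
  have m2 : Measurable (fun a : ℝ × ℝ => ri ε * ri ε * (ENNReal.ofReal |Real.sin (2 * Real.pi * a.1)| *
          ri (|(b - Real.cos (2 * Real.pi * a.2)) - Real.cos (2 * Real.pi * a.1)| + η))) := by
    refine (Measurable.mul ?_ (measurable_ri_comp (by fun_prop))).const_mul _
    exact ENNReal.measurable_ofReal.comp (by fun_prop)
  have m3 : Measurable (fun a : ℝ × ℝ => ri ε * ri ε * (ENNReal.ofReal |Real.sin (2 * Real.pi * a.2)| *
          ri (|(b - Real.cos (2 * Real.pi * a.1)) - Real.cos (2 * Real.pi * a.2)| + η))) := by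
    refine (Measurable.mul ?_ (measurable_ri_comp (by fun_prop))).const_mul _
    exact ENNReal.measurable_ofReal.comp (by fun_prop)
  have hεt : ri ε * ri ε ≠ ∞ := ENNReal.mul_ne_top (ri_ne_top hε0) (ri_ne_top hε0)
  have hvol : volume UI = 1 := by rw [Real.volume_Icc]; norm_num
  have i23 : ∀ γ : ℝ → ℝ, ∫⁻ y in UI, ∫⁻ x in UI, ri ε * ri ε * (ENNReal.ofReal |Real.sin (2 * Real.pi * x)| *
          ri (|γ y - Real.cos (2 * Real.pi * x)| + η)) ≤ ri ε * ri ε * ENNReal.ofReal (4 * -Real.log η) := by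
    intro γ
    calc _ ≤ ∫⁻ y in UI, ri ε * ri ε * ENNReal.ofReal (4 * -Real.log η) := by
          refine lintegral_mono fun y => ?_
          simp only
          rw [lintegral_const_mul' _ _ hεt]
          gcongr
          exact lint_cos_sin (γ y) h0 h1
      _ = _ := by rw [setLIntegral_const, hvol, mul_one]
  refine (lintegral_mono hpt).trans ?_
  rw [lintegral_add_left m1, lintegral_add_left m2]
  have i1 : ∫⁻ a in UI2, ri (Λ/2) * ((ri |Real.sin (2 * Real.pi * a.1)|) ^ (1/2 : ℝ) * (ri |Real.sin (2 * Real.pi * a.2)|) ^ (1/2 : ℝ)) ≤ ri (Λ/2) * (ENNReal.ofReal C * ENNReal.ofReal C) := by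
    rw [lintegral_const_mul' _ _ (ri_ne_top (by positivity))]
    gcongr
    rw [lint_UI2 (F := fun a => (ri |Real.sin (2 * Real.pi * a.1)|) ^ (1/2 : ℝ) * (ri |Real.sin (2 * Real.pi * a.2)|) ^ (1/2 : ℝ))
      ((ms.comp measurable_fst).mul (ms.comp measurable_snd))]
    simp only
    calc _ = ∫⁻ x in UI, (ri |Real.sin (2 * Real.pi * x)|) ^ (1/2 : ℝ) * ∫⁻ y in UI, (ri |Real.sin (2 * Real.pi * y)|) ^ (1/2 : ℝ) := by
          refine lintegral_congr fun x => ?_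
          rw [lintegral_const_mul _ ms]
      _ = (∫⁻ x in UI, (ri |Real.sin (2 * Real.pi * x)|) ^ (1/2 : ℝ)) * ∫⁻ y in UI, (ri |Real.sin (2 * Real.pi * y)|) ^ (1/2 : ℝ) := by
          rw [lintegral_mul_const _ ms]
      _ ≤ _ := by gcongr
  have i2 := i23 (fun y => b - Real.cos (2 * Real.pi * y))
  refine (add_le_add i1 (add_le_add ((lint_UI2' m2).le.trans i2) ((lint_UI2 m3).le.trans i2))).trans ?_
  rw [ri_eq hε0, ri_eq (by positivity)]
  rw [← ENNReal.ofReal_mul (by positivity), ← ENNReal.ofReal_mul (by positivity), ← ENNReal.ofReal_mul (by positivity),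
    ← ENNReal.ofReal_mul (by positivity), ← ENNReal.ofReal_add (by positivity) (by positivity),
    ← ENNReal.ofReal_add (by positivity) (by positivity)]
  apply ENNReal.ofReal_le_ofReal
  have hk : 0 ≤ 1 / (Λ/2) * C * C := by positivity
  nlinarith

/-- Splitting of the last coordinate in `ℝ³`. -/
def spl : (Fin 3 → ℝ) ≃ᵐ ℝ × (ℝ × ℝ) :=
  (MeasurableEquiv.piFinSuccAbove (fun _ : Fin 3 => ℝ) 2).trans
    (MeasurableEquiv.prodCongr (MeasurableEquiv.refl ℝ) MeasurableEquiv.finTwoArrow)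

lemma spl_apply (p : Fin 3 → ℝ) : spl p = (p 2, (p 0, p 1)) := rfl

lemma spl_symm (z : ℝ) (a : ℝ × ℝ) : spl.symm (z, a) = ![a.1, a.2, z] := by
  rw [MeasurableEquiv.symm_apply_eq, spl_apply]
  rfl

lemma spl_mp : MeasurePreserving spl volume volume := by
  have h1 := volume_preserving_piFinSuccAbove (fun _ : Fin 3 => ℝ) 2
  have h2 : MeasurePreserving (Prod.map (id : ℝ → ℝ) (MeasurableEquiv.finTwoArrow (α := ℝ)))
      (volume.prod volume) (volume.prod volume) :=
    (MeasurePreserving.id volume).prod (volume_preserving_finTwoArrow ℝ)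
  exact h2.comp h1

lemma spl_preimage : spl ⁻¹' (UI ×ˢ UI2) = T3 := by
  ext p
  simp only [Set.mem_preimage, spl_apply, T3, Set.mem_prod, Set.mem_pi, Set.mem_univ, true_imp_iff, Fin.forall_fin_succ,
    UI, UI2]
  simp
  tauto

lemma lint_T3 {F : (Fin 3 → ℝ) → ℝ≥0∞} (hF : Measurable F) :
    ∫⁻ p in T3, F p = ∫⁻ a in UI2, ∫⁻ z in UI, F ![a.1, a.2, z] := by
  have h := spl_mp.setLIntegral_comp_preimage_emb spl.measurableEmbedding (fun b => F (spl.symm b)) (UI ×ˢ UI2)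
  rw [spl_preimage] at h
  simp only [MeasurableEquiv.symm_apply_apply] at h
  rw [h, Measure.volume_eq_prod, ← Measure.prod_restrict, lintegral_prod_symm]
  · simp only [spl_symm]
  · exact (hF.comp spl.symm.measurable).aemeasurable

lemma lint_T3' {F : (Fin 3 → ℝ) → ℝ≥0∞} (hF : Measurable F) :
    ∫⁻ p in T3, F p = ∫⁻ z in UI, ∫⁻ a in UI2, F ![a.1, a.2, z] := by
  have h := spl_mp.setLIntegral_comp_preimage_emb spl.measurableEmbedding (fun b => F (spl.symm b)) (UI ×ˢ UI2)
  rw [spl_preimage] at h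
  simp only [MeasurableEquiv.symm_apply_apply] at h
  rw [h, Measure.volume_eq_prod, ← Measure.prod_restrict, lintegral_prod]
  · simp only [spl_symm]
  · exact (hF.comp spl.symm.measurable).aemeasurable

/-- The (regularized) free propagator. -/
def prp (α η : ℝ) (p : Fin 3 → ℝ) : ℝ≥0∞ := ri (|α - edisp p| + η)

/-- The Jacobian `sin p₀ sin r₁ - sin p₁ sin r₀`. -/
def jac (p r : Fin 3 → ℝ) : ℝ :=
  Real.sin (2 * Real.pi * p 0) * Real.sin (2 * Real.pi * r 1) -
    Real.sin (2 * Real.pi * p 1) * Real.sin (2 * Real.pi * r 0)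

lemma edisp_continuous : Continuous edisp := by unfold edisp; fun_prop

lemma edisp_measurable : Measurable edisp := edisp_continuous.measurable

lemma prp_measurable (α η : ℝ) : Measurable (prp α η) := by
  apply measurable_ri_comp
  have := edisp_measurable
  fun_prop

lemma prp_ne_top {α η : ℝ} (h : 0 < η) (p : Fin 3 → ℝ) : prp α η p ≠ ∞ :=
  ri_ne_top (by positivity)

lemma edisp_vec (x y z : ℝ) : edisp ![x, y, z] =
    3 - Real.cos (2 * Real.pi * x) - Real.cos (2 * Real.pi * y) - Real.cos (2 * Real.pi * z) := by
  simp [edisp, Fin.sum_univ_three]; ring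

lemma enn_mul_le (x y : ℝ≥0∞) : x * y ≤ x * x + y * y := by
  rcases le_total x y with h | h
  · exact (mul_le_mul_left h y).trans le_add_self
  · exact (mul_le_mul_right h x).trans le_self_add

lemma jac_continuous : Continuous (fun x : (Fin 3 → ℝ) × (Fin 3 → ℝ) => jac x.1 x.2) := by
  unfold jac; fun_prop

lemma kern_measurable (α η : ℝ) : Measurable (fun x : (Fin 3 → ℝ) × (Fin 3 → ℝ) =>
      prp α η x.1 * prp α η x.2 * ri (|jac x.1 x.2| + η ^ 2)) := by
  refine Measurable.mul (Measurable.mul ?_ ?_) (measurable_ri_comp ?_)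
  · exact (prp_measurable α η).comp measurable_fst
  · exact (prp_measurable α η).comp measurable_snd
  · have := jac_continuous.measurable
    fun_prop

lemma kern_measurable1 (α η : ℝ) (p : Fin 3 → ℝ) : Measurable (fun r : (Fin 3 → ℝ) =>
      prp α η p * prp α η r * ri (|jac p r| + η ^ 2)) := by
  refine Measurable.mul ((prp_measurable α η).const_mul _) (measurable_ri_comp ?_)
  have : Measurable (fun r => jac p r) := by unfold jac; fun_prop
  fun_prop

lemma kern_measurable2 (α η : ℝ) : Measurable (fun p : (Fin 3 → ℝ) =>
      ∫⁻ r in T3, prp α η p * prp α η r * ri (|jac p r| + η ^ 2)) :=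
  (kern_measurable α η).lintegral_prod_right'

set_option maxHeartbeats 1000000 in
lemma lint_K {Λ : ℝ} (hΛ : 0 < Λ) : ∃ C : ℝ, 0 < C ∧ ∀ η α : ℝ, 0 < η → η ≤ 1/2 →
    α ∈ Set.Icc (0:ℝ) 6 → Λ ≤ anorm α →
    ∫⁻ p in T3, ∫⁻ r in T3, prp α η p * prp α η r * ri (|jac p r| + η ^ 2) ≤
      ENNReal.ofReal (C * (-Real.log η) ^ 5) := by
  obtain ⟨C, hC, hfin⟩ := lint_final hΛ
  refine ⟨16 * 16 * 128 * 4 * 4 * C, by positivity, ?_⟩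
  intro η α h0 h1 hα hΛα
  have hL := neglog_pos h0 h1
  have hη2 : 0 < η ^ 2 := by positivity
  have hη2' : η ^ 2 ≤ 1/2 := by nlinarith
  set L := -Real.log η with hLdef
  set γ : ℝ × ℝ → ℝ := fun a => 3 - α - Real.cos (2 * Real.pi * a.1) - Real.cos (2 * Real.pi * a.2) with hγ
  have hγm : Measurable γ := by rw [hγ]; fun_prop
  have hγ5 : ∀ a, |γ a| ≤ 5 := by
    intro a
    have := Real.cos_le_one (2 * Real.pi * a.1)
    have := Real.cos_le_one (2 * Real.pi * a.2)
    have := Real.neg_one_le_cos (2 * Real.pi * a.1)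
    have := Real.neg_one_le_cos (2 * Real.pi * a.2)
    have := hα.1
    have := hα.2
    rw [abs_le]; constructor <;> simp only [hγ] <;> linarith
  have hprp : ∀ (a : ℝ × ℝ) (z : ℝ), prp α η ![a.1, a.2, z] = ri (|γ a - Real.cos (2 * Real.pi * z)| + η) := by
    intro a z
    rw [prp, edisp_vec, ← abs_neg]; congr 3; simp only [hγ]; ring
  set W : ℝ × ℝ → ℝ × ℝ → ℝ≥0∞ := fun a b =>
    ri (|Real.sin (2 * Real.pi * a.1) * Real.sin (2 * Real.pi * b.2) -
      Real.sin (2 * Real.pi * a.2) * Real.sin (2 * Real.pi * b.1)| + η ^ 2) with hW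
  have hWm : Measurable (Function.uncurry W) := by
    apply measurable_ri_comp; fun_prop
  have hWs : ∀ a b, W a b = W b a := by
    intro a b
    simp only [hW]
    rw [abs_sub_comm]; congr 3; ring
  have hWt : ∀ a b, W a b ≠ ∞ := fun a b => ri_ne_top (by positivity)
  have hjac : ∀ a b : ℝ × ℝ, ∀ z z' : ℝ, ri (|jac ![a.1, a.2, z] ![b.1, b.2, z']| + η ^ 2) = W a b := by
    intro a b z z'; simp [jac, hW]
  set S : ℝ × ℝ → ℝ≥0∞ := fun a => ri (|(|γ a| - 1)| + η) with hS
  set s : ℝ × ℝ → ℝ≥0∞ := fun a => ri (Real.sqrt (|(|γ a| - 1)| + η)) with hs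
  have hSm : Measurable S := by apply measurable_ri_comp; fun_prop
  have hss : ∀ a, s a * s a = S a := by
    intro a
    simp only [hs, hS]
    rw [← ri_mul (Real.sqrt_nonneg _), Real.mul_self_sqrt (by positivity)]
  set l := ENNReal.ofReal (16 * L) with hl
  have hlt : l ≠ ∞ := ENNReal.ofReal_ne_top
  set G : ℝ × ℝ → ℝ≥0∞ := fun a => ∫⁻ z in UI, prp α η ![a.1, a.2, z] with hG
  have hGle : ∀ a, G a ≤ l * s a := by
    intro a
    simp only [hG, hprp]
    exact lint_cos h0 h1 (hγ5 a)
  -- reduce to the pair integral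
  have e1 : ∀ p, ∫⁻ r in T3, prp α η p * prp α η r * ri (|jac p r| + η ^ 2) =
      ∫⁻ b in UI2, ∫⁻ z' in UI, prp α η p * prp α η ![b.1, b.2, z'] * ri (|jac p ![b.1, b.2, z']| + η ^ 2) := by
    intro p
    exact lint_T3 (F := fun r => prp α η p * prp α η r * ri (|jac p r| + η ^ 2))
      (kern_measurable1 α η p)
  have e2 : ∀ (a : ℝ × ℝ) (z : ℝ), ∫⁻ r in T3, prp α η ![a.1, a.2, z] * prp α η r * ri (|jac ![a.1, a.2, z] r| + η ^ 2)
      = prp α η ![a.1, a.2, z] * ∫⁻ b in UI2, W a b * G b := by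
    intro a z
    rw [e1]
    simp only [hjac]
    rw [← lintegral_const_mul' _ _ (prp_ne_top h0 _)]
    refine lintegral_congr fun b => ?_
    rw [← mul_assoc, hG]
    simp only
    rw [← lintegral_const_mul' _ _ (ENNReal.mul_ne_top (prp_ne_top h0 _) (hWt a b))]
    refine lintegral_congr fun z' => ?_
    ring
  have e3 : ∫⁻ p in T3, ∫⁻ r in T3, prp α η p * prp α η r * ri (|jac p r| + η ^ 2) =
      ∫⁻ a in UI2, G a * ∫⁻ b in UI2, W a b * G b := by
    rw [lint_T3 (F := fun p => ∫⁻ r in T3, prp α η p * prp α η r * ri (|jac p r| + η ^ 2))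
      (kern_measurable2 α η)]
    refine lintegral_congr fun a => ?_
    simp only [e2]
    rw [lintegral_mul_const]
    exact (prp_measurable α η).comp (measurable_pi_lambda _ (fun i => by fin_cases i <;> simp <;> fun_prop))
  rw [e3]
  have hWa : ∀ a, Measurable (W a) := by
    intro a; apply measurable_ri_comp; fun_prop
  have hpair : ∀ a, G a * ∫⁻ b in UI2, W a b * G b ≤
      l * l * (∫⁻ b in UI2, W a b * S a + W a b * S b) := by
    intro a
    have st : s a ≠ ∞ := ri_ne_top (Real.sqrt_pos.2 (by positivity))
    calc G a * ∫⁻ b in UI2, W a b * G b ≤ (l * s a) * ∫⁻ b in UI2, W a b * (l * s b) := by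
          gcongr with b
          · exact hGle a
          · exact hGle b
      _ = l * l * ∫⁻ b in UI2, W a b * (s a * s b) := by
          rw [← lintegral_const_mul' _ _ (ENNReal.mul_ne_top hlt st),
            ← lintegral_const_mul' _ _ (ENNReal.mul_ne_top hlt hlt)]
          refine lintegral_congr fun b => ?_
          ring
      _ ≤ _ := by
          gcongr with b
          rw [← mul_add, ← hss, ← hss]
          gcongr
          exact enn_mul_le _ _
  refine (lintegral_mono hpair).trans ?_
  rw [lintegral_const_mul' _ _ (ENNReal.mul_ne_top hlt hlt)]
  have hmm1 : Measurable (Function.uncurry fun a b => W a b * S a) := hWm.mul (hSm.comp measurable_fst)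
  have hmm2 : Measurable (Function.uncurry fun a b => W a b * S b) := hWm.mul (hSm.comp measurable_snd)
  have hsplit : ∫⁻ a in UI2, ∫⁻ b in UI2, W a b * S a + W a b * S b =
      2 * ∫⁻ a in UI2, ∫⁻ b in UI2, W a b * S a := by
    have q1 : ∀ a, ∫⁻ b in UI2, W a b * S a + W a b * S b = (∫⁻ b in UI2, W a b * S a) + ∫⁻ b in UI2, W a b * S b := by
      intro a
      rw [lintegral_add_left]
      exact (hWa a).mul_const _
    simp only [q1]
    have hm3 : Measurable (fun a => ∫⁻ b in UI2, W a b * S a) := hmm1.lintegral_prod_right'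
    rw [lintegral_add_left hm3, two_mul]
    congr 1
    rw [lintegral_lintegral_swap hmm2.aemeasurable]
    refine lintegral_congr fun a => lintegral_congr fun b => ?_
    rw [hWs]
  rw [hsplit]
  set A : ℝ≥0∞ := ENNReal.ofReal (128 * (-Real.log (η^2)) ^ 2) with hA
  have hin : ∀ a, ∫⁻ b in UI2, W a b * S a ≤
      A * (ri (|(3 - α - 1) - Real.cos (2 * Real.pi * a.1) - Real.cos (2 * Real.pi * a.2)| + η) *
      ri (max |Real.sin (2 * Real.pi * a.1)| |Real.sin (2 * Real.pi * a.2)|)) +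
      A * (ri (|(3 - α + 1) - Real.cos (2 * Real.pi * a.1) - Real.cos (2 * Real.pi * a.2)| + η) *
      ri (max |Real.sin (2 * Real.pi * a.1)| |Real.sin (2 * Real.pi * a.2)|)) := by
    intro a
    rw [lintegral_mul_const _ (hWa a)]
    have := lint_inner hη2 hη2' (Real.abs_sin_le_one (2 * Real.pi * a.1)) (Real.abs_sin_le_one (2 * Real.pi * a.2))
    have hSle : S a ≤ ri (|(3 - α - 1) - Real.cos (2 * Real.pi * a.1) - Real.cos (2 * Real.pi * a.2)| + η) +
        ri (|(3 - α + 1) - Real.cos (2 * Real.pi * a.1) - Real.cos (2 * Real.pi * a.2)| + η) := by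
      have g1 : (3 - α - 1) - Real.cos (2 * Real.pi * a.1) - Real.cos (2 * Real.pi * a.2) = γ a - 1 := by
        simp only [hγ]; ring
      have g2 : (3 - α + 1) - Real.cos (2 * Real.pi * a.1) - Real.cos (2 * Real.pi * a.2) = γ a + 1 := by
        simp only [hγ]; ring
      rw [g1, g2]
      simp only [hS]
      rcases le_total 0 (γ a) with h | h
      · rw [abs_of_nonneg h]; exact le_self_add
      · rw [abs_of_nonpos h, show -γ a - 1 = -(γ a + 1) by ring, abs_neg]; exact le_add_self
    refine (mul_le_mul' this hSle).trans (le_of_eq ?_)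
    ring
  have hAt : A ≠ ∞ := ENNReal.ofReal_ne_top
  have hmf : ∀ c : ℝ, Measurable (fun a : ℝ × ℝ => A * (ri (|c - Real.cos (2 * Real.pi * a.1) - Real.cos (2 * Real.pi * a.2)| + η) *
      ri (max |Real.sin (2 * Real.pi * a.1)| |Real.sin (2 * Real.pi * a.2)|))) := by
    intro c
    refine Measurable.const_mul (Measurable.mul (measurable_ri_comp ?_) (measurable_ri_comp ?_)) _ <;> fun_prop
  have b1 : Λ ≤ |α| ∧ Λ ≤ |α - 2| ∧ Λ ≤ |α - 4| ∧ Λ ≤ |α - 6| := by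
    simp only [anorm, le_min_iff] at hΛα
    tauto
  obtain ⟨b0, b2, b4, b6⟩ := b1
  have hbd : ∫⁻ a in UI2, ∫⁻ b in UI2, W a b * S a ≤ A * ENNReal.ofReal (C * L) + A * ENNReal.ofReal (C * L) := by
    refine (lintegral_mono hin).trans ?_
    rw [lintegral_add_left (hmf _), lintegral_const_mul' _ _ hAt, lintegral_const_mul' _ _ hAt]
    gcongr
    · refine hfin η _ h0 h1 ?_ ?_ ?_
      · rwa [show 3 - α - 1 = -(α - 2) by ring, abs_neg]
      · rwa [show 3 - α - 1 - 2 = -α by ring, abs_neg]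
      · rwa [show 3 - α - 1 + 2 = -(α - 4) by ring, abs_neg]
    · refine hfin η _ h0 h1 ?_ ?_ ?_
      · rwa [show 3 - α + 1 = -(α - 4) by ring, abs_neg]
      · rwa [show 3 - α + 1 - 2 = -(α - 2) by ring, abs_neg]
      · rwa [show 3 - α + 1 + 2 = -(α - 6) by ring, abs_neg]
  refine (mul_le_mul_right (mul_le_mul_right hbd 2) (l * l)).trans (le_of_eq ?_)
  have hA' : A = ENNReal.ofReal (128 * 4 * L ^ 2) := by
    rw [hA, Real.log_pow, hLdef]; congr 1; push_cast; ring
  rw [hA', hl, show (2:ℝ≥0∞) = ENNReal.ofReal 2 by simp]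
  rw [← ENNReal.ofReal_mul (by positivity), ← ENNReal.ofReal_mul (by positivity), 
    ← ENNReal.ofReal_add (by positivity) (by positivity), ← ENNReal.ofReal_mul (by positivity), 
    ← ENNReal.ofReal_mul (by positivity)]
  congr 1; ring

lemma area_ineq {Φ : ℝ × ℝ → ℝ × ℝ} {Φ' : ℝ × ℝ → (ℝ × ℝ) →L[ℝ] (ℝ × ℝ)} {S R : Set (ℝ × ℝ)}
    (hS : MeasurableSet S) (hR : MeasurableSet R) (hΦ : ∀ x ∈ S, HasFDerivAt Φ (Φ' x) x)
    (hdet : ∀ x ∈ S, (Φ' x).det ≠ 0) (hmap : ∀ x ∈ S, Φ x ∈ R) (N : ℕ)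
    (hN : ∀ (y : ℝ × ℝ) (F : Finset (ℝ × ℝ)), (∀ x ∈ F, x ∈ S ∧ Φ x = y) → F.card ≤ N)
    {g : ℝ × ℝ → ℝ≥0∞} (hg : Measurable g) :
    ∫⁻ x in S, ENNReal.ofReal |(Φ' x).det| * g (Φ x) ≤ N * ∫⁻ y in R, g y := by
  classical
  rcases S.eq_empty_or_nonempty with hE | hne
  · simp [hE]
  have hΦw : ∀ x ∈ S, HasFDerivWithinAt Φ (Φ' x) S x := fun x hx => (hΦ x hx).hasFDerivWithinAt
  have key : ∀ A : (ℝ × ℝ) →L[ℝ] (ℝ × ℝ), ∃ r : NNReal, r ≠ 0 ∧ (A.det ≠ 0 → ∀ s : Set (ℝ × ℝ),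
      ApproximatesLinearOn Φ A s r → Set.InjOn Φ s) := by
    intro A
    by_cases h : A.det ≠ 0
    · set B := A.toContinuousLinearEquivOfDetNeZero h with hB
      have hBp : 0 < ‖(B.symm : (ℝ × ℝ) →L[ℝ] (ℝ × ℝ))‖₊ := B.nnnorm_symm_pos
      refine ⟨‖(B.symm : (ℝ × ℝ) →L[ℝ] (ℝ × ℝ))‖₊⁻¹ / 2, by positivity, fun _ s hs => ?_⟩
      rw [← A.coe_toContinuousLinearEquivOfDetNeZero h] at hs
      exact hs.injOn (Or.inr (NNReal.half_lt_self (by positivity)))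
    · exact ⟨1, one_ne_zero, fun h' => absurd h' h⟩
  choose r hr0 hr using key
  obtain ⟨t, A, tdisj, tmeas, tcov, tapp, tA⟩ :=
    exists_partition_approximatesLinearOn_of_hasFDerivWithinAt Φ S Φ' hΦw r hr0
  set U : ℕ → Set (ℝ × ℝ) := fun n => S ∩ t n with hU
  have hUm : ∀ n, MeasurableSet (U n) := fun n => hS.inter (tmeas n)
  have hUinj : ∀ n, Set.InjOn Φ (U n) := by
    intro n
    obtain ⟨y, hy, hAy⟩ := tA hne n
    exact hr (A n) (hAy ▸ hdet y hy) _ (tapp n)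
  have hUd : Pairwise (Function.onFun Disjoint U) := fun i j hij =>
    (tdisj hij).mono Set.inter_subset_right Set.inter_subset_right
  have hUS : S = ⋃ n, U n := by
    rw [hU, ← Set.inter_iUnion]; exact (Set.inter_eq_left.2 tcov).symm
  have hUw : ∀ n, ∀ x ∈ U n, HasFDerivWithinAt Φ (Φ' x) (U n) x :=
    fun n x hx => (hΦ x hx.1).hasFDerivWithinAt
  have him : ∀ n, MeasurableSet (Φ '' U n) := fun n =>
    measurable_image_of_fderivWithin (hUm n) (hUw n) (hUinj n)
  calc ∫⁻ x in S, ENNReal.ofReal |(Φ' x).det| * g (Φ x)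
      = ∑' n, ∫⁻ x in U n, ENNReal.ofReal |(Φ' x).det| * g (Φ x) := by
        conv_lhs => rw [hUS]
        rw [lintegral_iUnion hUm hUd]
    _ = ∑' n, ∫⁻ y in Φ '' U n, g y := by
        congr 1; ext n
        rw [lintegral_image_eq_lintegral_abs_det_fderiv_mul volume (hUm n) (hUw n) (hUinj n)]
    _ = ∑' n, ∫⁻ y, (Φ '' U n).indicator g y := by
        congr 1; ext n
        rw [lintegral_indicator (him n)]
    _ = ∫⁻ y, ∑' n, (Φ '' U n).indicator g y := by
        rw [lintegral_tsum]
        exact fun n => (hg.indicator (him n)).aemeasurable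
    _ ≤ ∫⁻ y, R.indicator (fun y => N * g y) y := by
        refine lintegral_mono fun y => ?_
        rw [ENNReal.tsum_eq_iSup_sum]
        refine iSup_le fun F => ?_
        have h1 : ∑ n ∈ F, (Φ '' U n).indicator g y = ∑ n ∈ F.filter (fun n => y ∈ Φ '' U n), g y := by
          rw [Finset.sum_filter]
          refine Finset.sum_congr rfl fun n _ => ?_
          rw [Set.indicator_apply]
        rw [h1, Finset.sum_const, nsmul_eq_mul]
        set F' := F.filter (fun n => y ∈ Φ '' U n) with hF'
        have hex : ∀ n : F', ∃ x ∈ U n, Φ x = y := fun n => (Finset.mem_filter.1 n.2).2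
        choose x hxU hxy using hex
        have hxinj : Function.Injective x := by
          intro m n hmn
          by_contra hne'
          have : (m : ℕ) ≠ n := fun h => hne' (Subtype.ext h)
          exact Set.disjoint_left.1 (hUd this) (hxU m) (hmn ▸ hxU n)
        have hcard : F'.card ≤ N := by
          have := hN y (Finset.univ.image x) (by
            intro z hz
            obtain ⟨n, -, rfl⟩ := Finset.mem_image.1 hz
            exact ⟨(hxU n).1, hxy n⟩)
          rw [Finset.card_image_of_injective _ hxinj] at this
          simpa using this
        by_cases hy : y ∈ R
        · rw [Set.indicator_of_mem hy]
          gcongr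
        · have : F' = ∅ := by
            rw [Finset.eq_empty_iff_forall_notMem]
            intro n hn
            apply hy
            have h2 := hmap (x ⟨n, hn⟩) (hxU ⟨n, hn⟩).1
            rwa [hxy] at h2
          simp [this]
    _ = N * ∫⁻ y in R, g y := by
        rw [lintegral_indicator hR, lintegral_const_mul _ hg]

lemma quartic_card {q4 q3 q2 q1 q0 : ℝ} (h4 : q4 ≠ 0) (F : Finset ℝ)
    (hF : ∀ c ∈ F, q4 * c ^ 4 + q3 * c ^ 3 + q2 * c ^ 2 + q1 * c + q0 = 0) : F.card ≤ 4 := by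
  open Polynomial in
  let P : ℝ[X] := C q4 * X ^ 4 + C q3 * X ^ 3 + C q2 * X ^ 2 + C q1 * X + C q0
  have hd : P.natDegree ≤ 4 := by simp only [P]; compute_degree
  have hc : P.coeff 4 = q4 := by
    simp only [P]; compute_degree!
  have hP : P ≠ 0 := by
    intro h; rw [h] at hc; simp at hc; exact h4 hc.symm
  have hsub : F ⊆ P.roots.toFinset := by
    intro c hcF
    rw [Multiset.mem_toFinset, Polynomial.mem_roots hP, Polynomial.IsRoot.def]
    simpa [P] using hF c hcF
  calc F.card ≤ P.roots.toFinset.card := Finset.card_le_card hsub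
    _ ≤ Multiset.card P.roots := Multiset.toFinset_card_le _
    _ ≤ P.natDegree := P.card_roots'
    _ ≤ 4 := hd

lemma cos_inj_same {x x' : ℝ} (hx : x ∈ Set.Ioo (-(1/2):ℝ) (1/2)) (hx' : x' ∈ Set.Ioo (-(1/2):ℝ) (1/2))
    (h : Real.cos (2 * Real.pi * x) = Real.cos (2 * Real.pi * x')) : x = x' ∨ x = -x' := by
  have hpi := Real.pi_pos
  have h1 : Real.cos (2 * Real.pi * |x|) = Real.cos (2 * Real.pi * |x'|) := by
    rcases abs_choice x with e | e <;> rcases abs_choice x' with e' | e' <;> rw [e, e'] <;>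
      simp only [mul_neg, Real.cos_neg, h]
  have hb : ∀ {y : ℝ}, y ∈ Set.Ioo (-(1/2):ℝ) (1/2) → 2 * Real.pi * |y| ∈ Set.Icc 0 Real.pi := by
    intro y hy
    have : |y| < 1/2 := abs_lt.2 ⟨hy.1, hy.2⟩
    have := abs_nonneg y
    constructor
    · positivity
    · nlinarith
  have := Real.injOn_cos (hb hx) (hb hx') h1
  have : |x| = |x'| := by
    have h2 : 2 * Real.pi ≠ 0 := by positivity
    exact mul_left_cancel₀ h2 this
  exact abs_eq_abs.1 this

lemma cos_sin_inj {x x' : ℝ} (hx : x ∈ Set.Ioo (-(1/2):ℝ) (1/2)) (hx' : x' ∈ Set.Ioo (-(1/2):ℝ) (1/2))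
    (h : Real.cos (2 * Real.pi * x) = Real.cos (2 * Real.pi * x'))
    (h' : Real.sin (2 * Real.pi * x) = Real.sin (2 * Real.pi * x')) : x = x' := by
  have hpi := Real.pi_pos
  rcases cos_inj_same hx hx' h with e | e
  · exact e
  · subst e
    rw [mul_neg, Real.sin_neg] at h'
    have h0 : Real.sin (2 * Real.pi * x') = 0 := by linarith
    have := (Real.sin_eq_zero_iff_of_lt_of_lt (by nlinarith [hx'.1]) (by nlinarith [hx'.2])).1 h0
    have h2 : 2 * Real.pi ≠ 0 := by positivity
    have : x' = 0 := by simpa [h2] using this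
    simp [this]

/-- The energy map of a pair of planar momenta with fixed sum. -/
def PhiM (k l : ℝ) (a : ℝ × ℝ) : ℝ × ℝ :=
  (Real.cos (2 * Real.pi * a.1) + Real.cos (2 * Real.pi * a.2),
    Real.cos (2 * Real.pi * (k - a.1)) + Real.cos (2 * Real.pi * (l - a.2)))

lemma PhiM_mult {k l : ℝ} (hk : Real.sin (2 * Real.pi * k) ≠ 0) (hl : Real.sin (2 * Real.pi * l) ≠ 0)
    (hkl : Real.cos (2 * Real.pi * k) ≠ Real.cos (2 * Real.pi * l)) (y : ℝ × ℝ) (F : Finset (ℝ × ℝ))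
    (hF : ∀ x ∈ F, x ∈ Set.Ioo (-(1/2):ℝ) (1/2) ×ˢ Set.Ioo (-(1/2):ℝ) (1/2) ∧ PhiM k l x = y) :
    F.card ≤ 8 := by
  classical
  obtain ⟨E, E'⟩ := y
  set σ := Real.sin (2 * Real.pi * l) with hσ
  set ck := Real.cos (2 * Real.pi * k) with hck
  set cl := Real.cos (2 * Real.pi * l) with hcl
  set sk := Real.sin (2 * Real.pi * k) with hsk
  have hrel : ∀ a ∈ F, Real.cos (2 * Real.pi * a.2) = E - Real.cos (2 * Real.pi * a.1) ∧
      σ * Real.sin (2 * Real.pi * a.2) = E' - cl * E + (cl - ck) * Real.cos (2 * Real.pi * a.1)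
        - sk * Real.sin (2 * Real.pi * a.1) := by
    intro a ha
    have h := (hF a ha).2
    simp only [PhiM, Prod.mk.injEq] at h
    obtain ⟨h1, h2⟩ := h
    rw [mul_sub, mul_sub, Real.cos_sub, Real.cos_sub, ← hσ, ← hck, ← hcl, ← hsk] at h2
    refine ⟨by linarith, ?_⟩
    linear_combination h2 - cl * h1
  set e := E' - cl * E with he
  set b := cl - ck with hb
  have hb0 : b ≠ 0 := sub_ne_zero.2 (Ne.symm hkl)
  set a2 := -σ^2 - b^2 + sk^2 with ha2
  set a1 := 2 * σ^2 * E - 2 * e * b with ha1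
  set a0 := σ^2 * (1 - E^2) - e^2 - sk^2 with ha0
  set f : ℝ × ℝ → ℝ × Bool := fun a => (Real.cos (2 * Real.pi * a.1), decide (0 ≤ a.1)) with hf
  have hinj : Set.InjOn f F := by
    intro a ha a' ha' hh
    have ma := (hF a ha).1
    have ma' := (hF a' ha').1
    simp only [hf, Prod.mk.injEq, decide_eq_decide] at hh
    obtain ⟨h1, h2⟩ := hh
    have hx : a.1 = a'.1 := by
      rcases cos_inj_same ma.1 ma'.1 h1 with h | h
      · exact h
      · rcases le_total 0 a.1 with h3 | h3
        · have := h2.1 h3; linarith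
        · rcases le_total 0 a'.1 with h4 | h4
          · have := h2.2 h4; linarith
          · linarith
    obtain ⟨r1, r2⟩ := hrel a ha
    obtain ⟨r1', r2'⟩ := hrel a' ha'
    rw [hx] at r1 r2
    have hy : a.2 = a'.2 := by
      apply cos_sin_inj ma.2 ma'.2
      · rw [r1, r1']
      · exact mul_left_cancel₀ hl (r2.trans r2'.symm)
    exact Prod.ext hx hy
  set R := F.image (fun a => Real.cos (2 * Real.pi * a.1)) with hR
  have hRc : R.card ≤ 4 := by
    apply quartic_card (q4 := a2^2 + 4 * sk^2 * b^2) (q3 := 2 * a2 * a1 + 8 * sk^2 * e * b)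
      (q2 := a1^2 + 2 * a2 * a0 + 4 * sk^2 * e^2 - 4 * sk^2 * b^2) (q1 := 2 * a1 * a0 - 8 * sk^2 * e * b)
      (q0 := a0^2 - 4 * sk^2 * e^2)
    · positivity
    · intro c hc
      obtain ⟨a, ha, rfl⟩ := Finset.mem_image.1 hc
      obtain ⟨r1, r2⟩ := hrel a ha
      have hc1 := Real.sin_sq_add_cos_sq (2 * Real.pi * a.1)
      have hc2 := Real.sin_sq_add_cos_sq (2 * Real.pi * a.2)
      set c := Real.cos (2 * Real.pi * a.1)
      set s := Real.sin (2 * Real.pi * a.1)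
      set t := Real.sin (2 * Real.pi * a.2)
      rw [r1] at hc2
      have h3 : a2 * c^2 + a1 * c + a0 = - (2 * sk * (e + b * c)) * s := by
        have : σ^2 * t^2 = (e + b * c - sk * s)^2 := by rw [← r2]; ring
        have h5 : σ^2 * (1 - (E - c)^2) = (e + b * c - sk * s)^2 := by
          rw [← this, ← hc2]; ring
        have h6 : s^2 = 1 - c^2 := by linarith
        simp only [ha2, ha1, ha0]
        linear_combination h5 + sk^2 * h6
      have h4 : (a2 * c^2 + a1 * c + a0)^2 = 4 * sk^2 * (e + b * c)^2 * (1 - c^2) := by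
        rw [h3, ← hc1]; ring
      linear_combination h4
  have hsub : F.image f ⊆ R ×ˢ (Finset.univ : Finset Bool) := by
    intro z hz
    obtain ⟨a, ha, rfl⟩ := Finset.mem_image.1 hz
    simp only [hf, Finset.mem_product, Finset.mem_univ, and_true]
    exact Finset.mem_image_of_mem _ ha
  calc F.card = (F.image f).card := (Finset.card_image_of_injOn hinj).symm
    _ ≤ (R ×ˢ (Finset.univ : Finset Bool)).card := Finset.card_le_card hsub
    _ ≤ 8 := by rw [Finset.card_product]; simp; omega

/-- Derivative of `PhiM`. -/
def PhiM' (k l : ℝ) (a : ℝ × ℝ) : (ℝ × ℝ) →L[ℝ] (ℝ × ℝ) :=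
  LinearMap.toContinuousLinearMap (Matrix.toLin (Module.Basis.finTwoProd ℝ) (Module.Basis.finTwoProd ℝ)
    !![-(2 * Real.pi * Real.sin (2 * Real.pi * a.1)), -(2 * Real.pi * Real.sin (2 * Real.pi * a.2));
      2 * Real.pi * Real.sin (2 * Real.pi * (k - a.1)), 2 * Real.pi * Real.sin (2 * Real.pi * (l - a.2))])

lemma PhiM'_det (k l : ℝ) (a : ℝ × ℝ) (z z' : ℝ) : (PhiM' k l a).det =
    -(4 * Real.pi ^ 2 * jac ![a.1, a.2, z] ![k - a.1, l - a.2, z']) := by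
  simp only [PhiM', LinearMap.det_toContinuousLinearMap, LinearMap.det_toLin, Matrix.det_fin_two_of, jac]
  simp
  ring

lemma PhiM_hasFDerivAt (k l : ℝ) (a : ℝ × ℝ) : HasFDerivAt (PhiM k l) (PhiM' k l a) a := by
  unfold PhiM'
  rw [Matrix.toLin_finTwoProd_toContinuousLinearMap]
  have h1 : HasFDerivAt (fun b : ℝ × ℝ => b.1) (ContinuousLinearMap.fst ℝ ℝ ℝ) a := hasFDerivAt_fst
  have h2 : HasFDerivAt (fun b : ℝ × ℝ => b.2) (ContinuousLinearMap.snd ℝ ℝ ℝ) a := hasFDerivAt_snd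
  have c1 := (h1.const_mul (2 * Real.pi)).cos
  have c2 := (h2.const_mul (2 * Real.pi)).cos
  have c3 := ((h1.const_sub k).const_mul (2 * Real.pi)).cos
  have c4 := ((h2.const_sub l).const_mul (2 * Real.pi)).cos
  have h : HasFDerivAt (PhiM k l) _ a := (c1.add c2).prodMk (c3.add c4)
  refine h.congr_fderiv ?_
  ext <;> simp <;> ring

lemma lint_E {η a : ℝ} (h0 : 0 < η) (h1 : η ≤ 1/2) (ha : |a| ≤ 4) :
    ∫⁻ E in Set.Icc (-2:ℝ) 2, ri (|a - E| + η) ≤ ENNReal.ofReal (8 * (-Real.log η)) := by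
  have hI : ∫⁻ x in Set.Ioc (0:ℝ) 6, ri (|x| + η) ≤ ENNReal.ofReal (4 * (-Real.log η)) := by
    have h := lint_inv_add (a := 1) (b := 6) one_pos (by norm_num) h0
    have e : ∫⁻ x in Set.Ioc (0:ℝ) 6, ri (|x| + η) = ∫⁻ x in Set.Ioc (0:ℝ) 6, ri (1 * x + η) := by
      refine setLIntegral_congr_fun measurableSet_Ioc fun x hx => ?_
      rw [abs_of_pos hx.1, one_mul]
    rw [e, h]
    apply ENNReal.ofReal_le_ofReal
    rw [Real.log_div (by linarith) h0.ne']
    have h3 : Real.log (1 * 6 + η) ≤ 3 * Real.log 2 := by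
      have : 3 * Real.log 2 = Real.log (2 ^ 3) := by rw [Real.log_pow]; norm_num
      rw [this]
      exact Real.log_le_log (by linarith) (by linarith)
    have h4 := Real.log_le_log h0 h1
    rw [one_div, Real.log_inv] at h4
    rw [div_one, one_mul]
    linarith
  have m1 : ∫⁻ E in Set.Ioc a (a + 6), ri (|a - E| + η) = ∫⁻ x in Set.Ioc (0:ℝ) 6, ri (|x| + η) := by
    have h := (measurePreserving_add_left volume a).setLIntegral_comp_preimage_emb
      (MeasurableEquiv.addLeft a).measurableEmbedding (fun E => ri (|a - E| + η)) (Set.Ioc a (a + 6))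
    rw [← h]
    have : (fun x => a + x) ⁻¹' Set.Ioc a (a + 6) = Set.Ioc 0 6 := by
      ext x; simp
    rw [this]
    simp [abs_neg]
  have m2 : ∫⁻ E in Set.Ico (a - 6) a, ri (|a - E| + η) = ∫⁻ x in Set.Ioc (0:ℝ) 6, ri (|x| + η) := by
    have h := (Measure.measurePreserving_sub_left volume a).setLIntegral_comp_preimage_emb
      (MeasurableEquiv.subLeft a).measurableEmbedding (fun E => ri (|a - E| + η)) (Set.Ico (a - 6) a)
    rw [← h]
    have : (fun x => a - x) ⁻¹' Set.Ico (a - 6) a = Set.Ioc 0 6 := by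
      ext x; simp only [Set.mem_preimage, Set.mem_Ico, Set.mem_Ioc]
      constructor <;> rintro ⟨_, _⟩ <;> constructor <;> linarith
    rw [this]
    simp
  have hsub : Set.Icc (-2:ℝ) 2 ⊆ (Set.Ico (a - 6) a ∪ Set.Ioc a (a + 6)) ∪ {a} := by
    intro E hE
    obtain ⟨a1, a2⟩ := abs_le.1 ha
    obtain ⟨e1, e2⟩ := hE
    rcases lt_trichotomy E a with h | h | h
    · exact Or.inl (Or.inl ⟨by linarith, h⟩)
    · exact Or.inr h
    · exact Or.inl (Or.inr ⟨h, by linarith⟩)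
  have hL := neglog_pos h0 h1
  calc ∫⁻ E in Set.Icc (-2:ℝ) 2, ri (|a - E| + η)
      ≤ ∫⁻ E in (Set.Ico (a - 6) a ∪ Set.Ioc a (a + 6)) ∪ {a}, ri (|a - E| + η) := lintegral_mono_set hsub
    _ ≤ (∫⁻ E in (Set.Ico (a - 6) a ∪ Set.Ioc a (a + 6)), ri (|a - E| + η)) + ∫⁻ E in {a}, ri (|a - E| + η) :=
        lintegral_union_le _ _ _
    _ ≤ ((∫⁻ E in Set.Ico (a - 6) a, ri (|a - E| + η)) + ∫⁻ E in Set.Ioc a (a + 6), ri (|a - E| + η)) + 0 := by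
        gcongr
        · exact lintegral_union_le _ _ _
        · simp
    _ ≤ ENNReal.ofReal (4 * (-Real.log η)) + ENNReal.ofReal (4 * (-Real.log η)) := by
        rw [add_zero, m1, m2]; gcongr
    _ = _ := by rw [← ENNReal.ofReal_add (by linarith) (by linarith)]; congr 1; ring

lemma UI2_ae : (UI2 : Set (ℝ × ℝ)) =ᵐ[volume] Set.Ioo (-(1/2):ℝ) (1/2) ×ˢ Set.Ioo (-(1/2):ℝ) (1/2) := by
  have h : UI =ᵐ[volume] Set.Ioo (-(1/2):ℝ) (1/2) := Ioo_ae_eq_Icc.symm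
  rw [Measure.volume_eq_prod]
  exact Measure.set_prod_ae_eq h h

lemma jac_vec (a : ℝ × ℝ) (k l z z' w w' : ℝ) : jac ![a.1, a.2, z] ![k - a.1, l - a.2, z'] =
    jac ![a.1, a.2, w] ![k - a.1, l - a.2, w'] := by simp [jac]

/-- The planar integrand. -/
def FF (η a b : ℝ) (k l : ℝ) (x : ℝ × ℝ) : ℝ≥0∞ :=
  ENNReal.ofReal |jac ![x.1, x.2, 0] ![k - x.1, l - x.2, 0]| *
    (ri (|a - (PhiM k l x).1| + η) * ri (|b - (PhiM k l x).2| + η))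

lemma jac_cont2 : Continuous (fun y : (ℝ × ℝ) × (ℝ × ℝ) =>
    jac ![y.2.1, y.2.2, 0] ![y.1.1 - y.2.1, y.1.2 - y.2.2, 0]) := by
  simp only [jac]
  simp
  fun_prop

lemma PhiM_cont : Continuous (fun y : (ℝ × ℝ) × (ℝ × ℝ) => PhiM y.1.1 y.1.2 y.2) := by
  unfold PhiM; fun_prop

lemma FF_generic {η a b k l : ℝ} (h0 : 0 < η) (h1 : η ≤ 1/2) (ha : |a| ≤ 4) (hb : |b| ≤ 4)
    (hk : Real.sin (2 * Real.pi * k) ≠ 0) (hl : Real.sin (2 * Real.pi * l) ≠ 0)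
    (hkl : Real.cos (2 * Real.pi * k) ≠ Real.cos (2 * Real.pi * l)) :
    ∫⁻ x in UI2, FF η a b k l x ≤ ENNReal.ofReal (512 * (-Real.log η) ^ 2) := by
  have hL := neglog_pos h0 h1
  have hjm : Measurable (fun x : ℝ × ℝ => jac ![x.1, x.2, 0] ![k - x.1, l - x.2, 0]) :=
    (jac_cont2.comp (Continuous.prodMk (continuous_const (y := (k, l))) continuous_id)).measurable
  set O := Set.Ioo (-(1/2):ℝ) (1/2) ×ˢ Set.Ioo (-(1/2):ℝ) (1/2) with hO
  have hOm : MeasurableSet O := measurableSet_Ioo.prod measurableSet_Ioo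
  set S := O ∩ {x | jac ![x.1, x.2, 0] ![k - x.1, l - x.2, 0] ≠ 0} with hS
  have hSm : MeasurableSet S := hOm.inter (hjm (measurableSet_singleton 0).compl)
  set g : ℝ × ℝ → ℝ≥0∞ := fun y => ri (|a - y.1| + η) * ri (|b - y.2| + η) with hg
  have hgm : Measurable g := by
    apply Measurable.mul <;> apply measurable_ri_comp <;> fun_prop
  have hpi : (1:ℝ) ≤ 4 * Real.pi ^ 2 := by nlinarith [Real.pi_gt_three]
  have step1 : ∫⁻ x in UI2, FF η a b k l x = ∫⁻ x in S, FF η a b k l x := by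
    rw [setLIntegral_congr UI2_ae, ← hO, ← lintegral_indicator hOm, ← lintegral_indicator hSm]
    refine lintegral_congr fun x => ?_
    by_cases hx : x ∈ O
    · by_cases hj : jac ![x.1, x.2, 0] ![k - x.1, l - x.2, 0] = 0
      · have : x ∉ S := fun h => h.2 hj
        rw [Set.indicator_of_notMem this, Set.indicator_of_mem hx, FF, hj]; simp
      · have : x ∈ S := ⟨hx, hj⟩
        rw [Set.indicator_of_mem this, Set.indicator_of_mem hx]
    · have : x ∉ S := fun h => hx h.1
      rw [Set.indicator_of_notMem this, Set.indicator_of_notMem hx]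
  have step2 : ∫⁻ x in S, FF η a b k l x ≤
      ∫⁻ x in S, ENNReal.ofReal |(PhiM' k l x).det| * g (PhiM k l x) := by
    refine lintegral_mono fun x => ?_
    simp only [FF, hg]
    refine mul_le_mul_left (ENNReal.ofReal_le_ofReal ?_) _
    rw [PhiM'_det k l x 0 0, abs_neg, abs_mul, abs_of_nonneg (by positivity : (0:ℝ) ≤ 4 * Real.pi ^ 2)]
    have := abs_nonneg (jac ![x.1, x.2, 0] ![k - x.1, l - x.2, 0])
    nlinarith
  have hR : MeasurableSet (Set.Icc (-2:ℝ) 2 ×ˢ Set.Icc (-2:ℝ) 2) := measurableSet_Icc.prod measurableSet_Icc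
  have step3 := area_ineq (Φ := PhiM k l) (Φ' := PhiM' k l) hSm hR (fun x _ => PhiM_hasFDerivAt k l x)
    (by
      intro x hx
      rw [PhiM'_det k l x 0 0]
      have := hx.2
      simp only [Set.mem_ofPred_eq] at this
      have hp : 4 * Real.pi ^ 2 ≠ 0 := by positivity
      exact neg_ne_zero.2 (mul_ne_zero hp this))
    (by
      intro x hx
      have c1 := Real.cos_le_one (2 * Real.pi * x.1)
      have c2 := Real.cos_le_one (2 * Real.pi * x.2)
      have c3 := Real.cos_le_one (2 * Real.pi * (k - x.1))
      have c4 := Real.cos_le_one (2 * Real.pi * (l - x.2))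
      have d1 := Real.neg_one_le_cos (2 * Real.pi * x.1)
      have d2 := Real.neg_one_le_cos (2 * Real.pi * x.2)
      have d3 := Real.neg_one_le_cos (2 * Real.pi * (k - x.1))
      have d4 := Real.neg_one_le_cos (2 * Real.pi * (l - x.2))
      refine ⟨⟨?_, ?_⟩, ⟨?_, ?_⟩⟩ <;> simp only [PhiM] <;> linarith)
    8 (fun y F hF => PhiM_mult hk hl hkl y F (fun x hx => ⟨(hF x hx).1.1, (hF x hx).2⟩)) hgm
  rw [step1]
  refine (step2.trans step3).trans ?_
  have step4 : ∫⁻ y in Set.Icc (-2:ℝ) 2 ×ˢ Set.Icc (-2:ℝ) 2, g y ≤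
      ENNReal.ofReal (8 * (-Real.log η)) * ENNReal.ofReal (8 * (-Real.log η)) := by
    rw [Measure.volume_eq_prod, ← Measure.prod_restrict, lintegral_prod_mul
      (f := fun x => ri (|a - x| + η)) (g := fun x => ri (|b - x| + η))]
    · exact mul_le_mul' (lint_E h0 h1 ha) (lint_E h0 h1 hb)
    · apply Measurable.aemeasurable; apply measurable_ri_comp; fun_prop
    · apply Measurable.aemeasurable; apply measurable_ri_comp; fun_prop
  refine (mul_le_mul_right step4 _).trans (le_of_eq ?_)
  rw [show ((8:ℕ):ℝ≥0∞) = ENNReal.ofReal 8 by simp, ← ENNReal.ofReal_mul (by positivity),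
    ← ENNReal.ofReal_mul (by positivity)]
  congr 1; ring

lemma sin_zero_countable {a : ℝ} (ha : a ≠ 0) (b : ℝ) : {t : ℝ | Real.sin (a * t + b) = 0}.Countable := by
  refine (Set.countable_range (fun n : ℤ => ((n:ℝ) * Real.pi - b) / a)).mono ?_
  intro t ht
  obtain ⟨n, hn⟩ := Real.sin_eq_zero_iff.1 ht
  refine ⟨n, ?_⟩
  simp only
  rw [hn]; field_simp; ring

lemma generic_seq (k l : ℝ) : ∃ t : ℕ → ℝ, Tendsto t atTop (𝓝 0) ∧ ∀ n,
    Real.sin (2 * Real.pi * (k + t n)) ≠ 0 ∧ Real.sin (2 * Real.pi * (l + 2 * t n)) ≠ 0 ∧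
    Real.cos (2 * Real.pi * (k + t n)) ≠ Real.cos (2 * Real.pi * (l + 2 * t n)) := by
  have hpi := Real.pi_pos
  set Z : ℝ → ℝ → Set ℝ := fun a b => {t : ℝ | Real.sin (a * t + b) = 0} with hZ
  have hc : (Z (2 * Real.pi) (2 * Real.pi * k) ∪ Z (4 * Real.pi) (2 * Real.pi * l) ∪
      (Z (3 * Real.pi) (Real.pi * (k + l)) ∪ Z (-Real.pi) (Real.pi * (k - l)))).Countable :=
    ((sin_zero_countable (by positivity) _).union (sin_zero_countable (by positivity) _)).union
      ((sin_zero_countable (by positivity) _).union (sin_zero_countable (by simp) _))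
  have hd := hc.dense_compl ℝ
  obtain ⟨t, ht, ht0⟩ := mem_closure_iff_seq_limit.1 (hd 0)
  refine ⟨t, ht0, fun n => ?_⟩
  have h := ht n
  simp only [hZ, Set.mem_compl_iff, Set.mem_union, Set.mem_ofPred_eq, not_or] at h
  obtain ⟨⟨h1, h2⟩, h3, h4⟩ := h
  refine ⟨?_, ?_, ?_⟩
  · rwa [show 2 * Real.pi * (k + t n) = 2 * Real.pi * t n + 2 * Real.pi * k by ring]
  · rwa [show 2 * Real.pi * (l + 2 * t n) = 4 * Real.pi * t n + 2 * Real.pi * l by ring]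
  · rw [← sub_ne_zero, Real.cos_sub_cos]
    rw [show (2 * Real.pi * (k + t n) + 2 * Real.pi * (l + 2 * t n)) / 2 = 3 * Real.pi * t n + Real.pi * (k + l) by ring,
      show (2 * Real.pi * (k + t n) - 2 * Real.pi * (l + 2 * t n)) / 2 = -Real.pi * t n + Real.pi * (k - l) by ring]
    exact mul_ne_zero (mul_ne_zero (by norm_num) h3) h4

lemma ri_cont {X : Type*} [TopologicalSpace X] {f : X → ℝ} (hf : Continuous f) : Continuous (fun x => ri (f x)) := by
  unfold ri
  exact continuous_inv.comp (ENNReal.continuous_ofReal.comp hf)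

lemma FF_cont {η a b : ℝ} (h0 : 0 < η) : Continuous (fun y : (ℝ × ℝ) × (ℝ × ℝ) => FF η a b y.1.1 y.1.2 y.2) := by
  unfold FF
  have h1 := jac_cont2
  have h2 := PhiM_cont
  have c1 : Continuous (fun y : (ℝ × ℝ) × (ℝ × ℝ) => ENNReal.ofReal |jac ![y.2.1, y.2.2, 0] ![y.1.1 - y.2.1, y.1.2 - y.2.2, 0]|) :=
    ENNReal.continuous_ofReal.comp h1.abs
  have c2 : Continuous (fun y : (ℝ × ℝ) × (ℝ × ℝ) => ri (|a - (PhiM y.1.1 y.1.2 y.2).1| + η)) := by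
    apply ri_cont; fun_prop
  have c3 : Continuous (fun y : (ℝ × ℝ) × (ℝ × ℝ) => ri (|b - (PhiM y.1.1 y.1.2 y.2).2| + η)) := by
    apply ri_cont; fun_prop
  have n2 : ∀ y : (ℝ × ℝ) × (ℝ × ℝ), ri (|a - (PhiM y.1.1 y.1.2 y.2).1| + η) ≠ ∞ := fun y => ri_ne_top (by positivity)
  have n3 : ∀ y : (ℝ × ℝ) × (ℝ × ℝ), ri (|b - (PhiM y.1.1 y.1.2 y.2).2| + η) ≠ ∞ := fun y => ri_ne_top (by positivity)
  rw [continuous_iff_continuousAt]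
  intro y
  exact ENNReal.Tendsto.mul (c1.tendsto y) (Or.inr (ENNReal.mul_ne_top (n2 y) (n3 y)))
    (ENNReal.Tendsto.mul (c2.tendsto y) (Or.inr (n3 y)) (c3.tendsto y) (Or.inr (n2 y)))
    (Or.inr ENNReal.ofReal_ne_top)

lemma FF_meas {η a b : ℝ} (h0 : 0 < η) (k l : ℝ) : Measurable (FF η a b k l) := by
  have hc := FF_cont (a := a) (b := b) h0
  have c : Continuous (fun x : ℝ × ℝ => ((k, l), x)) := by fun_prop
  have h := hc.comp c
  simp only [Function.comp_def] at h
  exact h.measurable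

lemma FF_bound {η a b : ℝ} (k l : ℝ) (h0 : 0 < η) (h1 : η ≤ 1/2) (ha : |a| ≤ 4) (hb : |b| ≤ 4) :
    ∫⁻ x in UI2, FF η a b k l x ≤ ENNReal.ofReal (512 * (-Real.log η) ^ 2) := by
  obtain ⟨t, ht, hgen⟩ := generic_seq k l
  have hc := FF_cont (a := a) (b := b) h0
  have hlim : ∀ x, Tendsto (fun n => FF η a b (k + t n) (l + 2 * t n) x) atTop (𝓝 (FF η a b k l x)) := by
    intro x
    have h1 : Tendsto (fun n => ((k + t n, l + 2 * t n), x)) atTop (𝓝 ((k, l), x)) := by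
      refine Tendsto.prodMk_nhds (Tendsto.prodMk_nhds ?_ ?_) tendsto_const_nhds
      · simpa using ht.const_add k
      · simpa using (ht.const_mul 2).const_add l
    have h2 := (hc.tendsto ((k, l), x)).comp h1
    simp only [Function.comp_def] at h2
    exact h2
  have hm : ∀ n, Measurable (FF η a b (k + t n) (l + 2 * t n)) := fun n => FF_meas h0 _ _
  calc ∫⁻ x in UI2, FF η a b k l x
      = ∫⁻ x in UI2, liminf (fun n => FF η a b (k + t n) (l + 2 * t n) x) atTop :=
        lintegral_congr fun x => (hlim x).liminf_eq.symm
    _ ≤ liminf (fun n => ∫⁻ x in UI2, FF η a b (k + t n) (l + 2 * t n) x) atTop := lintegral_liminf_le hm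
    _ ≤ _ := by
        refine liminf_le_of_frequently_le' (Frequently.of_forall fun n => ?_)
        obtain ⟨g1, g2, g3⟩ := hgen n
        exact FF_generic h0 h1 ha hb g1 g2 g3


lemma vol_UI : volume UI = 1 := by
  rw [UI, Real.volume_Icc]; norm_num

lemma vol_UI2 : volume UI2 = 1 := by
  rw [UI2, Measure.volume_eq_prod, Measure.prod_prod, vol_UI, one_mul]

lemma jac_sub_meas (k : Fin 3 → ℝ) : Measurable (fun q => jac q (k - q)) := by
  have : Continuous (fun q => jac q (k - q)) := by unfold jac; simp only [Pi.sub_apply]; fun_prop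
  exact this.measurable

lemma A_bound {η α : ℝ} (h0 : 0 < η) (h1 : η ≤ 1/2) (hα : α ∈ Set.Icc (0:ℝ) 6) (k : Fin 3 → ℝ) :
    ∫⁻ q in T3, prp α η q * prp α η (k - q) * ENNReal.ofReal (|jac q (k - q)| + η ^ 2) ≤
      ENNReal.ofReal (516 * (-Real.log η) ^ 2) := by
  have hL := neglog_pos h0 h1
  have hm : Measurable (fun q => prp α η q * prp α η (k - q) * ENNReal.ofReal (|jac q (k - q)| + η ^ 2)) := by
    have hp := prp_measurable α η
    have hj := jac_sub_meas k
    refine ((hp.mul (hp.comp (measurable_const.sub measurable_id))).mul ?_)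
    exact ENNReal.measurable_ofReal.comp (by fun_prop)
  rw [lint_T3' hm]
  have hz : ∀ z : ℝ, ∫⁻ a in UI2, (prp α η ![a.1, a.2, z] * prp α η (k - ![a.1, a.2, z]) *
      ENNReal.ofReal (|jac ![a.1, a.2, z] (k - ![a.1, a.2, z])| + η ^ 2)) ≤
      ENNReal.ofReal (516 * (-Real.log η) ^ 2) := by
    intro z
    have hk : ∀ a : ℝ × ℝ, k - ![a.1, a.2, z] = ![k 0 - a.1, k 1 - a.2, k 2 - z] := by
      intro a; ext i; fin_cases i <;> simp
    set aa := 3 - α - Real.cos (2 * Real.pi * z) with haa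
    set bb := 3 - α - Real.cos (2 * Real.pi * (k 2 - z)) with hbb
    have hpt : ∀ a : ℝ × ℝ, prp α η ![a.1, a.2, z] * prp α η (k - ![a.1, a.2, z]) *
      ENNReal.ofReal (|jac ![a.1, a.2, z] (k - ![a.1, a.2, z])| + η ^ 2) ≤ FF η aa bb (k 0) (k 1) a + 1 := by
      intro a
      rw [hk, ENNReal.ofReal_add (abs_nonneg _) (by positivity), mul_add]
      have e1 : prp α η ![a.1, a.2, z] = ri (|aa - (PhiM (k 0) (k 1) a).1| + η) := by
        rw [prp, edisp_vec, ← abs_neg]; congr 3; simp only [PhiM, haa]; ring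
      have e2 : prp α η ![k 0 - a.1, k 1 - a.2, k 2 - z] = ri (|bb - (PhiM (k 0) (k 1) a).2| + η) := by
        rw [prp, edisp_vec, ← abs_neg]; congr 3; simp only [PhiM, hbb]; ring
      rw [e1, e2]
      refine add_le_add (le_of_eq ?_) ?_
      · rw [FF, jac_vec a (k 0) (k 1) z (k 2 - z) 0 0]; ring
      · have r1 : ri (|aa - (PhiM (k 0) (k 1) a).1| + η) ≤ ri η := ri_anti (by linarith [abs_nonneg (aa - (PhiM (k 0) (k 1) a).1)])
        have r2 : ri (|bb - (PhiM (k 0) (k 1) a).2| + η) ≤ ri η := ri_anti (by linarith [abs_nonneg (bb - (PhiM (k 0) (k 1) a).2)])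
        refine (mul_le_mul_left (mul_le_mul' r1 r2) _).trans (le_of_eq ?_)
        rw [ri_eq h0, ← ENNReal.ofReal_mul (by positivity), ← ENNReal.ofReal_mul (by positivity)]
        rw [show 1 / η * (1 / η) * η ^ 2 = 1 by field_simp]; simp
    refine (lintegral_mono hpt).trans ?_
    rw [lintegral_add_right _ measurable_const]
    have hA : ∀ w : ℝ, |3 - α - Real.cos w| ≤ 4 := by
      intro w
      have := Real.cos_le_one w
      have := Real.neg_one_le_cos w
      have := hα.1
      have := hα.2
      rw [abs_le]; constructor <;> linarith
    have := FF_bound (k 0) (k 1) h0 h1 (hA (2 * Real.pi * z)) (hA (2 * Real.pi * (k 2 - z)))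
    calc _ ≤ ENNReal.ofReal (512 * (-Real.log η) ^ 2) + 1 := by
          refine add_le_add this (le_of_eq ?_)
          rw [lintegral_const, Measure.restrict_apply_univ, vol_UI2, mul_one]
      _ ≤ _ := by
          rw [show (1:ℝ≥0∞) = ENNReal.ofReal 1 by simp, ← ENNReal.ofReal_add (by positivity) (by norm_num)]
          apply ENNReal.ofReal_le_ofReal
          nlinarith
  refine (lintegral_mono hz).trans (le_of_eq ?_)
  rw [lintegral_const, Measure.restrict_apply_univ, vol_UI, mul_one]

lemma lint_T3_iter {F : (Fin 3 → ℝ) → ℝ≥0∞} (hF : Measurable F) :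
    ∫⁻ p in T3, F p = ∫⁻ x in UI, ∫⁻ y in UI, ∫⁻ z in UI, F ![x, y, z] := by
  rw [lint_T3 hF]
  have hm : Measurable (fun a : ℝ × ℝ => ∫⁻ z in UI, F ![a.1, a.2, z]) := by
    have h : Measurable (fun b : (ℝ × ℝ) × ℝ => F ![b.1.1, b.1.2, b.2]) := by
      refine hF.comp (measurable_pi_lambda _ fun i => ?_)
      fin_cases i <;> simp <;> fun_prop
    exact h.lintegral_prod_right'
  rw [lint_UI2 hm]

lemma lint_T3_shift {G : (Fin 3 → ℝ) → ℝ≥0∞} (hG : Measurable G)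
    (hper : ∀ (r : Fin 3 → ℝ) (n : Fin 3 → ℤ), G (r + fun j => (n j : ℝ)) = G r) (c : Fin 3 → ℝ) :
    ∫⁻ r in T3, G (r + c) = ∫⁻ r in T3, G r := by
  rw [lint_T3_iter hG, lint_T3_iter (F := fun r => G (r + c)) (hG.comp (measurable_id.add_const c))]
  have hv : ∀ x y z : ℝ, (![x, y, z] : Fin 3 → ℝ) + c = ![x + c 0, y + c 1, z + c 2] := by
    intro x y z; ext i; fin_cases i <;> simp
  have p2 : ∀ x y : ℝ, Function.Periodic (fun z => G ![x, y, z]) 1 := by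
    intro x y z
    have := hper ![x, y, z] ![0, 0, 1]
    simp only
    rw [← this]; congr 1
    ext i; fin_cases i <;> simp
  have p1 : ∀ x : ℝ, Function.Periodic (fun y => ∫⁻ z in UI, G ![x, y, z]) 1 := by
    intro x y
    refine lintegral_congr fun z => ?_
    have := hper ![x, y, z] ![0, 1, 0]
    rw [← this]; congr 1
    ext i; fin_cases i <;> simp
  have p0 : Function.Periodic (fun x => ∫⁻ y in UI, ∫⁻ z in UI, G ![x, y, z]) 1 := by
    intro x
    refine lintegral_congr fun y => lintegral_congr fun z => ?_
    have := hper ![x, y, z] ![1, 0, 0]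
    rw [← this]; congr 1
    ext i; fin_cases i <;> simp
  simp only [hv]
  rw [← lint_shift p0 (c 0)]
  refine lintegral_congr fun x => ?_
  rw [← lint_shift (p1 (x + c 0)) (c 1)]
  refine lintegral_congr fun y => ?_
  exact lint_shift (p2 (x + c 0) (y + c 1)) (c 2)

lemma cos_per (x : ℝ) (n : ℤ) : Real.cos (2 * Real.pi * (x + n)) = Real.cos (2 * Real.pi * x) := by
  rw [show 2 * Real.pi * (x + n) = 2 * Real.pi * x + n * (2 * Real.pi) by ring, Real.cos_add_int_mul_two_pi]

lemma sin_per (x : ℝ) (n : ℤ) : Real.sin (2 * Real.pi * (x + n)) = Real.sin (2 * Real.pi * x) := by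
  rw [show 2 * Real.pi * (x + n) = 2 * Real.pi * x + n * (2 * Real.pi) by ring, Real.sin_add_int_mul_two_pi]

lemma prp_per (α η : ℝ) (r : Fin 3 → ℝ) (n : Fin 3 → ℤ) : prp α η (r + fun j => (n j : ℝ)) = prp α η r := by
  simp only [prp, edisp, Pi.add_apply, cos_per]

lemma jac_per (p r : Fin 3 → ℝ) (n : Fin 3 → ℤ) : jac p (r + fun j => (n j : ℝ)) = jac p r := by
  simp only [jac, Pi.add_apply, sin_per]

/-- Weight, and the pair kernels. -/
def WW (η : ℝ) (p r : Fin 3 → ℝ) : ℝ := |jac p r| + η ^ 2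

lemma WW_pos {η : ℝ} (h0 : 0 < η) (p r : Fin 3 → ℝ) : 0 < WW η p r := by unfold WW; positivity

lemma WW_cont (η : ℝ) : Continuous (fun x : (Fin 3 → ℝ) × (Fin 3 → ℝ) => WW η x.1 x.2) := by
  have := jac_continuous
  unfold WW; fun_prop

/-- `K1 = f f / W`. -/
def K1 (α η : ℝ) (p r : Fin 3 → ℝ) : ℝ≥0∞ := prp α η p * prp α η r * ri (WW η p r)
/-- `K2 = f f W`. -/
def K2 (α η : ℝ) (p r : Fin 3 → ℝ) : ℝ≥0∞ := prp α η p * prp α η r * ENNReal.ofReal (WW η p r)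

lemma WW_meas (η : ℝ) {X : Type*} [MeasurableSpace X] {f g : X → (Fin 3 → ℝ)}
    (hf : Measurable f) (hg : Measurable g) : Measurable (fun t => WW η (f t) (g t)) := by
  have h := (WW_cont η).measurable.comp (hf.prodMk hg)
  simp only [Function.comp_def] at h
  exact h

lemma K1_meas (α η : ℝ) {X : Type*} [MeasurableSpace X] {f g : X → (Fin 3 → ℝ)}
    (hf : Measurable f) (hg : Measurable g) : Measurable (fun t => K1 α η (f t) (g t)) :=
  (((prp_measurable α η).comp hf).mul ((prp_measurable α η).comp hg)).mul
    (measurable_ri_comp (WW_meas η hf hg))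

lemma K2_meas (α η : ℝ) {X : Type*} [MeasurableSpace X] {f g : X → (Fin 3 → ℝ)}
    (hf : Measurable f) (hg : Measurable g) : Measurable (fun t => K2 α η (f t) (g t)) :=
  (((prp_measurable α η).comp hf).mul ((prp_measurable α η).comp hg)).mul
    (ENNReal.measurable_ofReal.comp (WW_meas η hf hg))

lemma K1_ne_top {α η : ℝ} (h0 : 0 < η) (p r : Fin 3 → ℝ) : K1 α η p r ≠ ∞ :=
  ENNReal.mul_ne_top (ENNReal.mul_ne_top (prp_ne_top h0 _) (prp_ne_top h0 _)) (ri_ne_top (WW_pos h0 _ _))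

lemma K1_per (α η : ℝ) (p r : Fin 3 → ℝ) (n : Fin 3 → ℤ) : K1 α η p (r + fun j => (n j : ℝ)) = K1 α η p r := by
  simp only [K1, WW, jac_per, prp_per]

lemma K2_per (α η : ℝ) (p r : Fin 3 → ℝ) (n : Fin 3 → ℤ) : K2 α η p (r + fun j => (n j : ℝ)) = K2 α η p r := by
  simp only [K2, WW, jac_per, prp_per]

/-- The triple kernel. -/
def MM (α η : ℝ) (v x y z : Fin 3 → ℝ) : ℝ≥0∞ := K1 α η x y * K2 α η z (x + y + v - z)

lemma MM_meas (α η : ℝ) (v : Fin 3 → ℝ) {X : Type*} [MeasurableSpace X] {f g h : X → (Fin 3 → ℝ)}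
    (hf : Measurable f) (hg : Measurable g) (hh : Measurable h) :
    Measurable (fun t => MM α η v (f t) (g t) (h t)) := by
  have h1 : Measurable (fun t => K1 α η (f t) (g t)) := K1_meas α η hf hg
  have h2 : Measurable (fun t => K2 α η (h t) (f t + g t + v - h t)) :=
    K2_meas α η hh (((hf.add hg).add_const v).sub hh)
  exact h1.mul h2

lemma MM_bound {α η : ℝ} (h0 : 0 < η) (v : Fin 3 → ℝ) {A : ℝ≥0∞}
    (hA : ∀ k, ∫⁻ q in T3, K2 α η q (k - q) ≤ A) :
    ∫⁻ x in T3, ∫⁻ y in T3, ∫⁻ z in T3, MM α η v x y z ≤ (∫⁻ x in T3, ∫⁻ y in T3, K1 α η x y) * A := by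
  have h1 : ∀ x y, ∫⁻ z in T3, MM α η v x y z ≤ K1 α η x y * A := by
    intro x y
    unfold MM
    rw [lintegral_const_mul' _ _ (K1_ne_top h0 _ _)]
    exact mul_le_mul_right (hA _) _
  have h2 : ∀ x, ∫⁻ y in T3, ∫⁻ z in T3, MM α η v x y z ≤ (∫⁻ y in T3, K1 α η x y) * A := by
    intro x
    refine (lintegral_mono (h1 x)).trans (le_of_eq ?_)
    rw [lintegral_mul_const]
    exact K1_meas α η measurable_const measurable_id
  refine (lintegral_mono h2).trans (le_of_eq ?_)
  rw [lintegral_mul_const]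
  exact (K1_meas α η measurable_fst measurable_snd).lintegral_prod_right'

lemma MM_swap1 (α η : ℝ) (v : Fin 3 → ℝ) :
    ∫⁻ p in T3, ∫⁻ q in T3, ∫⁻ r in T3, MM α η v p r q = ∫⁻ p in T3, ∫⁻ r in T3, ∫⁻ q in T3, MM α η v p r q := by
  refine lintegral_congr fun p => ?_
  rw [lintegral_lintegral_swap]
  exact (MM_meas α η v measurable_const measurable_snd measurable_fst).aemeasurable

lemma MM_swap2 (α η : ℝ) (v : Fin 3 → ℝ) :
    ∫⁻ p in T3, ∫⁻ q in T3, ∫⁻ w in T3, MM α η v q w p = ∫⁻ q in T3, ∫⁻ w in T3, ∫⁻ p in T3, MM α η v q w p := by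
  have h : Measurable (fun x : (Fin 3 → ℝ) × (Fin 3 → ℝ) => ∫⁻ w in T3, MM α η v x.2 w x.1) := by
    have : Measurable (fun t : ((Fin 3 → ℝ) × (Fin 3 → ℝ)) × (Fin 3 → ℝ) => MM α η v t.1.2 t.2 t.1.1) :=
      MM_meas α η v (measurable_snd.comp measurable_fst) measurable_snd (measurable_fst.comp measurable_fst)
    exact this.lintegral_prod_right'
  rw [lintegral_lintegral_swap h.aemeasurable]
  refine lintegral_congr fun q => ?_
  rw [lintegral_lintegral_swap]
  exact (MM_meas α η v measurable_const measurable_snd measurable_fst).aemeasurable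

lemma J_bound {α η : ℝ} (h0 : 0 < η) (u : Fin 3 → ℝ) {A : ℝ≥0∞}
    (hA : ∀ k, ∫⁻ q in T3, K2 α η q (k - q) ≤ A) :
    ∫⁻ p in T3, ∫⁻ q in T3, ∫⁻ r in T3, prp α η p * prp α η q * prp α η r * prp α η (p - q + r - u) ≤
      2 * ((∫⁻ x in T3, ∫⁻ y in T3, K1 α η x y) * A) := by
  have hpt : ∀ p q r, prp α η p * prp α η q * prp α η r * prp α η (p - q + r - u) ≤
      MM α η (-u) p r q + K1 α η q (p - q + r - u) * K2 α η p r := by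
    intro p q r
    have ew : p + r + -u - q = p - q + r - u := by abel
    rw [MM, ew]
    set w := p - q + r - u
    have hone : 1 ≤ ri (WW η p r) * ENNReal.ofReal (WW η q w) + ri (WW η q w) * ENNReal.ofReal (WW η p r) := by
      have aux : ∀ a b : ℝ, 0 < a → a ≤ b → 1 ≤ ri a * ENNReal.ofReal b := by
        intro a b ha hab
        rw [ri_eq ha, ← ENNReal.ofReal_mul (by positivity), ENNReal.one_le_ofReal, one_div, ← div_eq_inv_mul]
        exact (one_le_div ha).2 hab
      rcases le_total (WW η p r) (WW η q w) with h | h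
      · exact (aux _ _ (WW_pos h0 _ _) h).trans le_self_add
      · exact (aux _ _ (WW_pos h0 _ _) h).trans le_add_self
    calc prp α η p * prp α η q * prp α η r * prp α η w
        = (prp α η p * prp α η q * prp α η r * prp α η w) * 1 := by rw [mul_one]
      _ ≤ (prp α η p * prp α η q * prp α η r * prp α η w) * _ := mul_le_mul_right hone _
      _ = _ := by rw [K1, K1, K2, K2]; ring
  have hm1 : ∀ p q, Measurable (fun r => MM α η (-u) p r q) := fun p q =>
    MM_meas α η _ measurable_const measurable_id measurable_const
  have hm2 : ∀ p, Measurable (fun q => ∫⁻ r in T3, MM α η (-u) p r q) := by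
    intro p
    have : Measurable (fun t : (Fin 3 → ℝ) × (Fin 3 → ℝ) => MM α η (-u) p t.2 t.1) :=
      MM_meas α η _ measurable_const measurable_snd measurable_fst
    exact this.lintegral_prod_right'
  have hm3 : Measurable (fun p => ∫⁻ q in T3, ∫⁻ r in T3, MM α η (-u) p r q) := by
    have h1 : Measurable (fun t : ((Fin 3 → ℝ) × (Fin 3 → ℝ)) × (Fin 3 → ℝ) => MM α η (-u) t.1.1 t.2 t.1.2) :=
      MM_meas α η _ (measurable_fst.comp measurable_fst) measurable_snd (measurable_snd.comp measurable_fst)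
    have h2 : Measurable (fun t : ((Fin 3 → ℝ) × (Fin 3 → ℝ)) => ∫⁻ r in T3, MM α η (-u) t.1 r t.2) :=
      h1.lintegral_prod_right'
    exact h2.lintegral_prod_right'
  have hshift : ∀ p q, ∫⁻ r in T3, K1 α η q (p - q + r - u) * K2 α η p r = ∫⁻ w in T3, MM α η u q w p := by
    intro p q
    have hGm : Measurable (fun r => K1 α η q (p - q + r - u) * K2 α η p r) := by
      refine Measurable.mul ?_ ?_
      · exact K1_meas α η measurable_const ((measurable_id.const_add (p - q)).sub_const u)
      · exact K2_meas α η measurable_const measurable_id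
    have := lint_T3_shift hGm (by
      intro r n
      rw [show p - q + (r + fun j => (n j : ℝ)) - u = (p - q + r - u) + fun j => (n j : ℝ) by abel]
      rw [K1_per, K2_per]) (q - p + u)
    rw [← this]
    refine lintegral_congr fun w => ?_
    rw [MM]
    congr 2 <;> abel
  calc _ ≤ ∫⁻ p in T3, ∫⁻ q in T3, ∫⁻ r in T3, (MM α η (-u) p r q + K1 α η q (p - q + r - u) * K2 α η p r) :=
        lintegral_mono fun p => lintegral_mono fun q => lintegral_mono fun r => hpt p q r
    _ = (∫⁻ p in T3, ∫⁻ q in T3, ∫⁻ r in T3, MM α η (-u) p r q) +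
        ∫⁻ p in T3, ∫⁻ q in T3, ∫⁻ w in T3, MM α η u q w p := by
        rw [← lintegral_add_left hm3]
        refine lintegral_congr fun p => ?_
        rw [← lintegral_add_left (hm2 p)]
        refine lintegral_congr fun q => ?_
        rw [lintegral_add_left (hm1 p q), hshift]
    _ ≤ (∫⁻ x in T3, ∫⁻ y in T3, K1 α η x y) * A + (∫⁻ x in T3, ∫⁻ y in T3, K1 α η x y) * A := by
        rw [MM_swap1, MM_swap2]
        exact add_le_add (MM_bound h0 _ hA) (MM_bound h0 _ hA)
    _ = _ := (two_mul _).symm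

lemma J_final {Λ : ℝ} (hΛ : 0 < Λ) : ∃ C : ℝ, 0 < C ∧ ∀ η α : ℝ, 0 < η → η ≤ 1/2 →
    α ∈ Set.Icc (0:ℝ) 6 → Λ ≤ anorm α → ∀ u : Fin 3 → ℝ,
    ∫⁻ p in T3, ∫⁻ q in T3, ∫⁻ r in T3, prp α η p * prp α η q * prp α η r * prp α η (p - q + r - u) ≤
      ENNReal.ofReal (C * (-Real.log η) ^ 7) := by
  obtain ⟨C, hC, hK⟩ := lint_K hΛ
  refine ⟨2 * (C * 516), by positivity, ?_⟩
  intro η α h0 h1 hα hΛα u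
  have hL := neglog_pos h0 h1
  refine (J_bound h0 u (A_bound h0 h1 hα)).trans ?_
  refine (mul_le_mul_right (mul_le_mul_left (hK η α h0 h1 hα hΛα) _) 2).trans (le_of_eq ?_)
  rw [show (2:ℝ≥0∞) = ENNReal.ofReal 2 by simp, ← ENNReal.ofReal_mul (by positivity),
    ← ENNReal.ofReal_mul (by positivity)]
  congr 1; ring

lemma lint_mm_pow {s : ℝ} (hs0 : 0 ≤ s) (hs : s < 1) : ∃ C : ℝ, 0 < C ∧ ∀ φ : ℝ,
    ∫⁻ x in UI, (ri (mm φ x)) ^ s ≤ ENNReal.ofReal C := by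
  obtain ⟨C, hC, h⟩ := lint_pow hs0 hs
  refine ⟨C + C, by positivity, fun φ => ?_⟩
  have hpt : ∀ x, (ri (mm φ x)) ^ s ≤
      (ri |Real.sin (Real.pi * x + φ)|) ^ s + (ri |Real.sin (Real.pi * x + -φ)|) ^ s := by
    intro x
    refine (ENNReal.rpow_le_rpow (ri_min _ _) hs0).trans ?_
    exact ENNReal.rpow_add_le_add_rpow _ _ hs0 hs.le
  refine (lintegral_mono hpt).trans ?_
  rw [lintegral_add_left, ENNReal.ofReal_add hC.le hC.le]
  · exact add_le_add (h _) (h _)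
  · exact (measurable_ri_comp (by fun_prop)).pow_const _

lemma abs_abs_sub_one (γ : ℝ) : min |γ - 1| |γ + 1| ≤ |(|γ| - 1)| := by
  rcases le_total 0 γ with h | h
  · rw [abs_of_nonneg h]; exact min_le_left _ _
  · rw [abs_of_nonpos h]
    refine (min_le_right _ _).trans (le_of_eq ?_)
    rw [← abs_neg]; congr 1; ring

lemma ri_min_pow (x y : ℝ) {s : ℝ} (hs0 : 0 ≤ s) (hs : s ≤ 1) :
    (ri (min x y)) ^ s ≤ (ri x) ^ s + (ri y) ^ s :=
  (ENNReal.rpow_le_rpow (ri_min _ _) hs0).trans (ENNReal.rpow_add_le_add_rpow _ _ hs0 hs)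

lemma ri_sq {x : ℝ} (hx : 0 ≤ x) (s : ℝ) : (ri (x ^ 2)) ^ s = (ri x) ^ (2 * s) := by
  rw [ENNReal.rpow_mul, pow_two, ri_mul hx]
  congr 1
  norm_num [pow_two]

lemma lint_line : ∃ C : ℝ, 0 < C ∧ ∀ γ : ℝ,
    ∫⁻ x in UI, (ri |γ - Real.cos (2 * Real.pi * x)|) ^ (1/2 : ℝ) ≤
      ((ri |γ - 1|) ^ (1/8 : ℝ) + (ri |γ + 1|) ^ (1/8 : ℝ)) * ENNReal.ofReal C := by
  obtain ⟨C, hC, h⟩ := lint_mm_pow (s := 3/4) (by norm_num) (by norm_num)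
  refine ⟨C, hC, fun γ => ?_⟩
  obtain ⟨φ, hφ⟩ := cos_gap γ
  have hpt : ∀ x, (ri |γ - Real.cos (2 * Real.pi * x)|) ^ (1/2 : ℝ) ≤
      ((ri |γ - 1|) ^ (1/8 : ℝ) + (ri |γ + 1|) ^ (1/8 : ℝ)) * (ri (mm φ x)) ^ (3/4 : ℝ) := by
    intro x
    obtain ⟨a, b, -⟩ := hφ x
    have hm := mm_nonneg φ x
    set X := |γ - Real.cos (2 * Real.pi * x)|
    have e1 : (ri X) ^ (1/2 : ℝ) = (ri X) ^ (1/4 : ℝ) * (ri X) ^ (1/4 : ℝ) := by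
      rw [← ENNReal.rpow_add_of_nonneg _ _ (by norm_num) (by norm_num)]; norm_num
    have e2 : (ri X) ^ (1/4 : ℝ) ≤ (ri |(|γ| - 1)|) ^ (1/8 : ℝ) * (ri (mm φ x)) ^ (1/4 : ℝ) := by
      refine (ENNReal.rpow_le_rpow (ri_anti a) (by norm_num)).trans (le_of_eq ?_)
      rw [ri_mul (Real.sqrt_nonneg _), ENNReal.mul_rpow_of_nonneg _ _ (by norm_num)]
      congr 1
      conv_rhs => rw [← Real.sq_sqrt (abs_nonneg (|γ| - 1)), ri_sq (Real.sqrt_nonneg _)]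
      norm_num
    have e3 : (ri X) ^ (1/4 : ℝ) ≤ (ri (mm φ x)) ^ (1/2 : ℝ) := by
      refine (ENNReal.rpow_le_rpow (ri_anti b) (by norm_num)).trans (le_of_eq ?_)
      rw [ri_sq hm]; norm_num
    have e4 : (ri |(|γ| - 1)|) ^ (1/8 : ℝ) ≤ (ri |γ - 1|) ^ (1/8 : ℝ) + (ri |γ + 1|) ^ (1/8 : ℝ) :=
      (ENNReal.rpow_le_rpow (ri_anti (abs_abs_sub_one γ)) (by norm_num)).trans
        (ri_min_pow _ _ (by norm_num) (by norm_num))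
    rw [e1]
    refine (mul_le_mul' (e2.trans (mul_le_mul' e4 le_rfl)) e3).trans (le_of_eq ?_)
    rw [mul_assoc, ← ENNReal.rpow_add_of_nonneg _ _ (by norm_num) (by norm_num)]; norm_num
  refine (lintegral_mono hpt).trans ?_
  rw [lintegral_const_mul]
  · exact mul_le_mul' le_rfl (h φ)
  · refine Measurable.pow_const (measurable_ri_comp ?_) _
    unfold mm; fun_prop

lemma lint_line8 : ∃ C : ℝ, 0 < C ∧ ∀ γ : ℝ,
    ∫⁻ x in UI, (ri |γ - Real.cos (2 * Real.pi * x)|) ^ (1/8 : ℝ) ≤ ENNReal.ofReal C := by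
  obtain ⟨C, hC, h⟩ := lint_mm_pow (s := 1/4) (by norm_num) (by norm_num)
  refine ⟨C, hC, fun γ => ?_⟩
  obtain ⟨φ, hφ⟩ := cos_gap γ
  refine (lintegral_mono fun x => ?_).trans (h φ)
  obtain ⟨-, b, -⟩ := hφ x
  refine (ENNReal.rpow_le_rpow (ri_anti b) (by norm_num)).trans (le_of_eq ?_)
  rw [ri_sq (mm_nonneg φ x)]; norm_num

lemma lint_plane : ∃ C : ℝ, 0 < C ∧ ∀ c : ℝ,
    ∫⁻ a in UI2, (ri |c - Real.cos (2 * Real.pi * a.1) - Real.cos (2 * Real.pi * a.2)|) ^ (1/2 : ℝ)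
      ≤ ENNReal.ofReal C := by
  obtain ⟨C, hC, h⟩ := lint_line
  obtain ⟨D, hD, h8⟩ := lint_line8
  refine ⟨(D + D) * C, by positivity, fun c => ?_⟩
  rw [lint_UI2 (F := fun a => (ri |c - Real.cos (2 * Real.pi * a.1) - Real.cos (2 * Real.pi * a.2)|) ^ (1/2 : ℝ))
    (Measurable.pow_const (measurable_ri_comp (by fun_prop)) _)]
  refine (lintegral_mono fun x => h (c - Real.cos (2 * Real.pi * x))).trans ?_
  have e : ∀ x : ℝ, (ri |c - Real.cos (2 * Real.pi * x) - 1|) ^ (1/8 : ℝ) + (ri |c - Real.cos (2 * Real.pi * x) + 1|) ^ (1/8 : ℝ)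
     = (ri |(c - 1) - Real.cos (2 * Real.pi * x)|) ^ (1/8 : ℝ) + (ri |(c + 1) - Real.cos (2 * Real.pi * x)|) ^ (1/8 : ℝ) := by
    intro x
    rw [sub_right_comm, show c - Real.cos (2 * Real.pi * x) + 1 = (c + 1) - Real.cos (2 * Real.pi * x) by ring]
  simp only [e]
  rw [lintegral_mul_const' _ _ ENNReal.ofReal_ne_top, lintegral_add_left, ENNReal.ofReal_mul (by positivity),
    ENNReal.ofReal_add hD.le hD.le]
  · exact mul_le_mul' (add_le_add (h8 _) (h8 _)) le_rfl
  · exact Measurable.pow_const (measurable_ri_comp (by fun_prop)) _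

lemma circ_int {f : ℂ → ℂ} (hf : DiffContOnCl ℂ f (Metric.ball 0 1)) :
    ∫ x in (-(1/2) : ℝ)..(1/2), f (Complex.exp (((2 * Real.pi * x : ℝ) : ℂ) * Complex.I)) = f 0 := by
  have h1 : Real.circleAverage f 0 1 = f 0 := by
    apply DiffContOnCl.circleAverage
    simpa using hf
  have hpi : (2 * Real.pi) ≠ 0 := by positivity
  rw [← h1, Real.circleAverage_eq_integral_add (-Real.pi)]
  have h2 := intervalIntegral.integral_comp_mul_left (a := -(1/2)) (b := 1/2) (fun θ : ℝ => f (circleMap 0 1 θ)) hpi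
  simp only [circleMap_zero, Complex.ofReal_one, one_mul] at h2
  rw [h2]
  congr 1
  have h3 := intervalIntegral.integral_comp_add_right (a := 0) (b := 2 * Real.pi) (fun θ : ℝ => f (circleMap 0 1 θ)) (-Real.pi)
  rw [h3]
  simp only [circleMap_zero, Complex.ofReal_one, one_mul]
  congr 1 <;> ring

lemma dcc {ζ : ℂ} (hζ : ‖ζ‖ < 1) : DiffContOnCl ℂ (fun z => (1 + ζ * z)⁻¹) (Metric.ball 0 1) := by
  have hne : ∀ z ∈ Metric.closedBall (0:ℂ) 1, 1 + ζ * z ≠ 0 := by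
    intro z hz h0
    have hz1 : ‖z‖ ≤ 1 := by simpa using hz
    have : ‖ζ * z‖ = 1 := by
      rw [show ζ * z = -1 by linear_combination h0]; simp
    rw [norm_mul] at this
    nlinarith [norm_nonneg ζ, norm_nonneg z]
  have hd : DifferentiableOn ℂ (fun z => (1 + ζ * z)⁻¹) (Metric.closedBall 0 1) := by
    intro z hz
    have := hne z hz
    apply DifferentiableAt.differentiableWithinAt
    fun_prop (disch := assumption)
  refine ⟨hd.mono Metric.ball_subset_closedBall, ?_⟩
  rw [closure_ball _ one_ne_zero]
  exact hd.continuousOn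

lemma root_exists {w : ℂ} (hw : 0 < w.im) : ∃ ζ D : ℂ, ‖ζ‖ < 1 ∧ 2 * ζ * w = ζ ^ 2 + 1 ∧ D ^ 2 = w ^ 2 - 1 ∧
    ‖1 - ζ ^ 2‖ = 2 * ‖D‖ * ‖ζ‖ ∧ ζ ≠ 0 := by
  obtain ⟨D, hD⟩ := IsAlgClosed.exists_pow_nat_eq (w ^ 2 - 1) (n := 2) (by norm_num)
  have key : ∀ D : ℂ, D ^ 2 = w ^ 2 - 1 → ‖w - D‖ ≤ ‖w + D‖ → ∃ ζ D : ℂ, ‖ζ‖ < 1 ∧ 2 * ζ * w = ζ ^ 2 + 1 ∧ D ^ 2 = w ^ 2 - 1 ∧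
    ‖1 - ζ ^ 2‖ = 2 * ‖D‖ * ‖ζ‖ ∧ ζ ≠ 0 := by
    intro D hD hle
    have hp : (w - D) * (w + D) = 1 := by linear_combination -hD
    have hn : ‖w - D‖ * ‖w + D‖ = 1 := by rw [← norm_mul, hp, norm_one]
    have h0 : w - D ≠ 0 := by intro h; rw [h] at hp; simp at hp
    refine ⟨w - D, D, ?_, ?_, hD, ?_, h0⟩
    · by_contra hge
      push Not at hge
      have h1 : ‖w - D‖ = 1 := by nlinarith [norm_nonneg (w - D)]
      have h2 : w + D = (starRingEnd ℂ) (w - D) := by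
        have : (w - D) * (starRingEnd ℂ) (w - D) = 1 := by
          rw [Complex.mul_conj, Complex.normSq_eq_norm_sq, h1]; norm_num
        exact mul_left_cancel₀ h0 (hp.trans this.symm)
      have h3 := congrArg Complex.im h2
      simp at h3
      linarith
    · linear_combination -hD
    · have : 1 - (w - D) ^ 2 = 2 * D * (w - D) := by linear_combination -hp
      rw [this]; simp
  rcases le_total ‖w - D‖ ‖w + D‖ with h | h
  · exact key D hD h
  · exact key (-D) (by rw [neg_sq]; exact hD) (by simpa [sub_eq_add_neg] using h)

lemma h_norm {w : ℂ} (hw : 0 < w.im) : ∃ D : ℂ, D ^ 2 = w ^ 2 - 1 ∧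
    ‖∫ x in (-(1/2) : ℝ)..(1/2), (w + (Real.cos (2 * Real.pi * x) : ℂ))⁻¹‖ = ‖D‖⁻¹ := by
  obtain ⟨ζ, D, h1, h2, h3, h4, h5⟩ := root_exists hw
  refine ⟨D, h3, ?_⟩
  have hζ2 : 1 - ζ ^ 2 ≠ 0 := by
    intro h
    have : ‖ζ ^ 2‖ = 1 := by rw [show ζ ^ 2 = 1 by linear_combination -h]; simp
    rw [norm_pow] at this
    nlinarith [norm_nonneg ζ]
  set E : ℝ → ℂ := fun x => Complex.exp (((2 * Real.pi * x : ℝ) : ℂ) * Complex.I) with hE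
  have hEn : ∀ x, ‖E x‖ = 1 := fun x => Complex.norm_exp_ofReal_mul_I _
  have hEc : Continuous E := by rw [hE]; fun_prop
  have hEE : ∀ x, E x * E (-x) = 1 := by
    intro x; simp only [hE]
    rw [← Complex.exp_add]; push_cast; ring_nf; simp
  have hne : ∀ x, 1 + ζ * E x ≠ 0 := by
    intro x h
    have : ‖ζ * E x‖ = 1 := by
      rw [show ζ * E x = -1 by linear_combination h]; simp
    rw [norm_mul, hEn] at this
    linarith
  have hcos : ∀ x : ℝ, (Real.cos (2 * Real.pi * x) : ℂ) = (E x + E (-x)) / 2 := by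
    intro x
    rw [Complex.ofReal_cos, Complex.cos]
    simp only [hE]; push_cast; ring_nf
  have hpt : ∀ x : ℝ, (w + (Real.cos (2 * Real.pi * x) : ℂ))⁻¹ =
      (2 * ζ / (1 - ζ ^ 2)) * ((1 + ζ * E x)⁻¹ + (1 + ζ * E (-x))⁻¹ - 1) := by
    intro x
    have a := hne x
    have b := hne (-x)
    have c : 2 * ζ * (w + (Real.cos (2 * Real.pi * x) : ℂ)) = (1 + ζ * E x) * (1 + ζ * E (-x)) := by
      rw [hcos]; linear_combination h2 - ζ ^ 2 * hEE x
    have d : w + (Real.cos (2 * Real.pi * x) : ℂ) = (1 + ζ * E x) * (1 + ζ * E (-x)) / (2 * ζ) := by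
      rw [← c]; field_simp
    rw [d]
    have e : (1 + ζ * E x)⁻¹ + (1 + ζ * E (-x))⁻¹ - 1 = (1 - ζ ^ 2) / ((1 + ζ * E x) * (1 + ζ * E (-x))) := by
      rw [eq_div_iff (mul_ne_zero a b)]
      have a' := mul_inv_cancel₀ a
      have b' := mul_inv_cancel₀ b
      linear_combination (1 + ζ * E (-x)) * a' + (1 + ζ * E x) * b' - ζ ^ 2 * hEE x
    rw [e]; field_simp
  have i1 : ∫ x in (-(1/2) : ℝ)..(1/2), (1 + ζ * E x)⁻¹ = 1 := by
    have := circ_int (dcc h1)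
    rw [mul_zero, add_zero, inv_one] at this
    exact this
  have i2 : ∫ x in (-(1/2) : ℝ)..(1/2), (1 + ζ * E (-x))⁻¹ = 1 := by
    rw [intervalIntegral.integral_comp_neg (fun x => (1 + ζ * E x)⁻¹), neg_neg, i1]
  have c1 : Continuous (fun x => (1 + ζ * E x)⁻¹) := Continuous.inv₀ (by fun_prop) hne
  have c2 : Continuous (fun x => (1 + ζ * E (-x))⁻¹) := Continuous.inv₀ (by fun_prop) (fun x => hne _)
  simp only [hpt]
  rw [intervalIntegral.integral_const_mul, intervalIntegral.integral_sub
    (IntervalIntegrable.add (c1.intervalIntegrable _ _) (c2.intervalIntegrable _ _)) (by simp),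
    intervalIntegral.integral_add (c1.intervalIntegrable _ _) (c2.intervalIntegrable _ _), i1, i2]
  have : (1 + 1 - ∫ x in (-(1/2) : ℝ)..(1/2), (1:ℂ)) = 1 := by
    rw [intervalIntegral.integral_const]; norm_num
  rw [this, mul_one, norm_div, h4, norm_mul]
  have hz : ‖ζ‖ ≠ 0 := by simpa using h5
  have hD0 : ‖D‖ ≠ 0 := by
    intro h; rw [h] at h4; simp at h4; exact hζ2 h4
  simp
  field_simp

lemma h_bound {w : ℂ} (hw : 0 < w.im) :
    ‖∫ x in UI, (w + (Real.cos (2 * Real.pi * x) : ℂ))⁻¹‖ₑ ≤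
      (ri |w.re - 1|) ^ (1/2 : ℝ) + (ri |w.re + 1|) ^ (1/2 : ℝ) := by
  obtain ⟨D, h1, h2⟩ := h_norm hw
  rw [UI, integral_Icc_eq_integral_Ioc, ← intervalIntegral.integral_of_le (by norm_num),
    ← ofReal_norm, h2]
  have hD : ‖D‖ ^ 2 = ‖w - 1‖ * ‖w + 1‖ := by
    rw [← norm_pow, h1, ← norm_mul]; congr 1; ring
  have a1 : |w.re - 1| ≤ ‖w - 1‖ := by simpa using Complex.abs_re_le_norm (w - 1)
  have a2 : |w.re + 1| ≤ ‖w + 1‖ := by simpa using Complex.abs_re_le_norm (w + 1)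
  have a3 : min |w.re - 1| |w.re + 1| ≤ |w.re - 1| * |w.re + 1| := by
    have : 2 ≤ |w.re - 1| + |w.re + 1| := by
      have := abs_sub (w.re + 1) (w.re - 1)
      ring_nf at this ⊢
      norm_num at this
      linarith
    rcases le_total |w.re - 1| |w.re + 1| with h | h
    · rw [min_eq_left h]; nlinarith [abs_nonneg (w.re - 1)]
    · rw [min_eq_right h]; nlinarith [abs_nonneg (w.re + 1)]
  have a4 : min |w.re - 1| |w.re + 1| ≤ ‖D‖ ^ 2 := by
    rw [hD]; exact a3.trans (mul_le_mul a1 a2 (abs_nonneg _) (norm_nonneg _))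
  have hpos : 0 < ‖D‖ := by
    have : D ≠ 0 := by
      intro h
      rw [h] at hD
      have b1 : w.im ≤ ‖w - 1‖ := by simpa using Complex.im_le_norm (w - 1)
      have b2 : w.im ≤ ‖w + 1‖ := by simpa using Complex.im_le_norm (w + 1)
      have := mul_pos (hw.trans_le b1) (hw.trans_le b2)
      simp at hD
      rcases hD with h | h <;> rw [h] at this <;> simp at this
    simpa using this
  have : ENNReal.ofReal ‖D‖⁻¹ = (ri (‖D‖ ^ 2)) ^ (1/2 : ℝ) := by
    rw [ri_sq hpos.le, ri, ENNReal.ofReal_inv_of_pos hpos]; norm_num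
  rw [this]
  exact (ENNReal.rpow_le_rpow (ri_anti a4) (by norm_num)).trans
        (ri_min_pow _ _ (by norm_num) (by norm_num))

lemma prop_ne {ε : ℝ} (hε : 0 < ε) (a : ℝ) (p : Fin 3 → ℝ) :
    (a : ℂ) - (edisp p : ℂ) + (ε : ℂ) * Complex.I ≠ 0 := by
  intro h
  have := congrArg Complex.im h
  simp at this
  linarith

lemma prop_cont {ε : ℝ} (hε : 0 < ε) (a : ℝ) :
    Continuous (fun p => ((a : ℂ) - (edisp p : ℂ) + (ε : ℂ) * Complex.I)⁻¹) := by
  have := edisp_continuous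
  exact Continuous.inv₀ (by fun_prop) (prop_ne hε a)

lemma T3_compact : IsCompact T3 := isCompact_univ_pi fun _ => isCompact_Icc

lemma prop_int {ε : ℝ} (hε : 0 < ε) (a : ℝ) :
    IntegrableOn (fun p => ((a : ℂ) - (edisp p : ℂ) + (ε : ℂ) * Complex.I)⁻¹) T3 :=
  (prop_cont hε a).continuousOn.integrableOn_compact T3_compact

lemma Theta_im {ε : ℝ} (hε : 0 < ε) (a : ℝ) : (ThetaEps ε a).im ≤ 0 := by
  unfold ThetaEps
  have h := Complex.imCLM.integral_comp_comm (prop_int hε a)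
  simp only [Complex.imCLM_apply] at h
  rw [← h]
  refine integral_nonpos fun p => ?_
  simp only [Pi.zero_apply, Complex.inv_im]
  refine div_nonpos_of_nonpos_of_nonneg ?_ (Complex.normSq_nonneg _)
  simp [hε.le]

lemma Theta_fubini {ε : ℝ} (hε : 0 < ε) (a : ℝ) : ThetaEps ε a = ∫ b in UI2, ∫ z in UI,
    ((a : ℂ) - (edisp ![b.1, b.2, z] : ℂ) + (ε : ℂ) * Complex.I)⁻¹ := by
  unfold ThetaEps
  have h := spl_mp.setIntegral_preimage_emb spl.measurableEmbedding
    (fun b => ((a : ℂ) - (edisp (spl.symm b) : ℂ) + (ε : ℂ) * Complex.I)⁻¹) (UI ×ˢ UI2)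
  have hi := (spl_mp.integrableOn_comp_preimage spl.measurableEmbedding
    (f := (fun b => ((a : ℂ) - (edisp (spl.symm b) : ℂ) + (ε : ℂ) * Complex.I)⁻¹)) (s := UI ×ˢ UI2))
  rw [spl_preimage] at h hi
  simp only [Function.comp_def, MeasurableEquiv.symm_apply_apply] at h hi
  have hi' := hi.1 (prop_int hε a)
  rw [IntegrableOn, Measure.volume_eq_prod, ← Measure.prod_restrict] at hi'
  rw [h, Measure.volume_eq_prod, ← Measure.prod_restrict, integral_prod_symm _ hi']
  simp only [spl_symm, Measure.volume_eq_prod]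

lemma Theta_bound : ∃ B : ℝ, 0 < B ∧ ∀ ε a : ℝ, 0 < ε → ‖ThetaEps ε a‖ ≤ B := by
  obtain ⟨C, hC, h⟩ := lint_plane
  refine ⟨C + C, by positivity, fun ε a hε => ?_⟩
  rw [Theta_fubini hε]
  have key : ‖∫ b in UI2, ∫ z in UI,
    ((a : ℂ) - (edisp ![b.1, b.2, z] : ℂ) + (ε : ℂ) * Complex.I)⁻¹‖ₑ ≤ ENNReal.ofReal (C + C) := by
    refine (enorm_integral_le_lintegral_enorm _).trans ?_
    have hpt : ∀ b : ℝ × ℝ, ‖∫ z in UI, ((a : ℂ) - (edisp ![b.1, b.2, z] : ℂ) + (ε : ℂ) * Complex.I)⁻¹‖ₑ ≤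
        (ri |(4 - a) - Real.cos (2 * Real.pi * b.1) - Real.cos (2 * Real.pi * b.2)|) ^ (1/2 : ℝ) +
        (ri |(2 - a) - Real.cos (2 * Real.pi * b.1) - Real.cos (2 * Real.pi * b.2)|) ^ (1/2 : ℝ) := by
      intro b
      set w : ℂ := ((a - 3 + Real.cos (2 * Real.pi * b.1) + Real.cos (2 * Real.pi * b.2) : ℝ) : ℂ) +
        (ε : ℂ) * Complex.I with hw
      have hre : w.re = a - 3 + Real.cos (2 * Real.pi * b.1) + Real.cos (2 * Real.pi * b.2) := by
        rw [hw]; simp only [Complex.add_re, Complex.ofReal_re, Complex.mul_re, Complex.I_re, Complex.ofReal_im,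
          Complex.I_im]; ring
      have him : w.im = ε := by
        rw [hw]; simp only [Complex.add_im, Complex.ofReal_re, Complex.mul_im, Complex.I_re, Complex.ofReal_im,
          Complex.I_im]; ring
      have hb := h_bound (w := w) (by rw [him]; exact hε)
      have e : ∀ z : ℝ, (a : ℂ) - (edisp ![b.1, b.2, z] : ℂ) + (ε : ℂ) * Complex.I =
          w + (Real.cos (2 * Real.pi * z) : ℂ) := by
        intro z; rw [edisp_vec, hw]; push_cast; ring
      simp only [e]
      refine hb.trans (le_of_eq ?_)
      rw [hre, abs_sub_comm _ (1:ℝ), ← abs_neg (_ + (1:ℝ))]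
      congr 4 <;> ring
    refine (lintegral_mono hpt).trans ?_
    rw [lintegral_add_left, ENNReal.ofReal_add hC.le hC.le]
    · exact add_le_add (h _) (h _)
    · exact Measurable.pow_const (measurable_ri_comp (by fun_prop)) _
  rw [← ofReal_norm] at key
  exact (ENNReal.ofReal_le_ofReal_iff (by positivity)).1 key

lemma Theta_lim : ∃ B : ℝ, 0 < B ∧ ∀ Θ : ℝ → ℂ, IsThetaLimit Θ → ∀ a, ‖Θ a‖ ≤ B ∧ (Θ a).im ≤ 0 := by
  obtain ⟨B, hB, h⟩ := Theta_bound
  refine ⟨B, hB, fun Θ hΘ a => ⟨?_, ?_⟩⟩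
  · refine le_of_tendsto (hΘ a).norm ?_
    filter_upwards [self_mem_nhdsWithin] with ε hε
    exact h ε a hε
  · refine le_of_tendsto ((Complex.continuous_im.tendsto _).comp (hΘ a)) ?_
    filter_upwards [self_mem_nhdsWithin] with ε hε
    exact Theta_im hε a

lemma den_bound {B lam κ η a x : ℝ} {θ : ℂ} (hB : 0 < B) (h0 : 0 < lam) (h1 : lam ≤ 1) (hκ : 0 < κ)
    (hη : η = lam ^ (2 + κ)) (hθ : ‖θ‖ ≤ B) (hi : θ.im ≤ 0) :
    1 / ‖(a : ℂ) - (starRingEnd ℂ) ((x : ℂ) + (lam : ℂ) ^ 2 * θ) - (η : ℂ) * Complex.I‖ ≤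
      (2 + B) * lam ^ (-κ) * (1 / (|a - x| + η)) := by
  have hη0 : 0 < η := by rw [hη]; positivity
  set N := (a : ℂ) - (starRingEnd ℂ) ((x : ℂ) + (lam : ℂ) ^ 2 * θ) - (η : ℂ) * Complex.I with hN
  have pr : ((lam : ℂ) ^ 2).re = lam ^ 2 := by rw [← Complex.ofReal_pow, Complex.ofReal_re]
  have pi0 : ((lam : ℂ) ^ 2).im = 0 := by rw [← Complex.ofReal_pow, Complex.ofReal_im]
  have hre : N.re = a - x - lam ^ 2 * θ.re := by
    rw [hN]; simp [pr, pi0]; ring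
  have him : N.im = lam ^ 2 * θ.im - η := by
    rw [hN]; simp [pr, pi0]
  have b1 : η ≤ ‖N‖ := by
    have := Complex.abs_im_le_norm N
    have h2 : η ≤ |N.im| := by
      rw [him, abs_of_nonpos] <;> nlinarith [sq_nonneg lam]
    linarith
  have hk1 : 1 ≤ lam ^ (-κ) := Real.one_le_rpow_of_pos_of_le_one_of_nonpos h0 h1 (by linarith)
  have hl2 : lam ^ 2 = lam ^ (-κ) * η := by
    rw [hη, ← Real.rpow_add h0, ← Real.rpow_natCast]; congr 1; norm_num
  have b2 : |a - x| ≤ ‖N‖ + lam ^ 2 * B := by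
    have h3 := Complex.abs_re_le_norm N
    have h4 : |θ.re| ≤ B := (Complex.abs_re_le_norm θ).trans hθ
    have h5 : a - x = N.re + lam ^ 2 * θ.re := by rw [hre]; ring
    rw [h5]
    refine (abs_add_le _ _).trans ?_
    rw [abs_mul, abs_of_nonneg (sq_nonneg lam)]
    gcongr
  have hNpos : 0 < ‖N‖ := hη0.trans_le b1
  have b3 : |a - x| + η ≤ (2 + B) * lam ^ (-κ) * ‖N‖ := by
    rw [hl2] at b2
    have h6 : lam ^ (-κ) * η * B ≤ lam ^ (-κ) * ‖N‖ * B := by gcongr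
    have h7 : ‖N‖ ≤ lam ^ (-κ) * ‖N‖ := le_mul_of_one_le_left hNpos.le hk1
    nlinarith
  rw [mul_one_div, div_le_div_iff₀ hNpos (by positivity)]
  linarith


/-- For `0 < κ ≤ 1/12` and `Λ > 0` there are `C_Λ > 0` and `λ₀ ∈ (0,1)`
such that for `0 < λ ≤ λ₀`, with `η = λ^{2+κ}`, every `α ∈ [0,6]` with `|||α||| ≥ Λ` and
every `u ∈ 𝕋³`, the four-denominator integral with renormalized propagators is at most
`C_Λ λ^{-4κ} |log η|^{14}`. -/
theorem statement12 (κ Λ : ℝ) (hκ0 : 0 < κ) (hκ : κ ≤ 1/12) (hΛ : 0 < Λ) :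
    ∃ C lam0 : ℝ, 0 < C ∧ lam0 ∈ Set.Ioo (0 : ℝ) 1 ∧
      ∀ Θ : ℝ → ℂ, IsThetaLimit Θ →
        ∀ lam : ℝ, 0 < lam → lam ≤ lam0 →
          ∀ η : ℝ, η = lam ^ (2 + κ) →
            ∀ α : ℝ, α ∈ Set.Icc (0 : ℝ) 6 → Λ ≤ anorm α →
              ∀ u : Fin 3 → ℝ,
                (∫ p in T3, ∫ q in T3, ∫ r in T3,
                    1 /
                      (‖(α : ℂ) - (starRingEnd ℂ) (omegaR Θ lam p) - (η : ℂ) * Complex.I‖ *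
                        ‖(α : ℂ) - (starRingEnd ℂ) (omegaR Θ lam q) - (η : ℂ) * Complex.I‖ *
                        ‖(α : ℂ) - (starRingEnd ℂ) (omegaR Θ lam r) - (η : ℂ) * Complex.I‖ *
                        ‖(α : ℂ) - (starRingEnd ℂ) (omegaR Θ lam (p - q + r - u)) -
                          (η : ℂ) * Complex.I‖)) ≤
                  C * lam ^ (-(4 * κ)) * |Real.log η| ^ (14 : ℕ) := by
  obtain ⟨C, hC, hJ⟩ := J_final hΛ
  obtain ⟨B, hB, hT⟩ := Theta_lim
  refine ⟨(2 + B) ^ 4 * C, 1 / 2, by positivity, ⟨by norm_num, by norm_num⟩, ?_⟩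
  intro Θ hΘ lam hl0 hl1 η hη α hα hΛα u
  have hη0 : 0 < η := by rw [hη]; positivity
  have hη4 : η ≤ 1 / 4 := by
    have h2 : lam ^ (2 + κ) ≤ lam ^ (2 : ℝ) :=
      Real.rpow_le_rpow_of_exponent_ge hl0 (by linarith) (by linarith)
    rw [Real.rpow_two] at h2
    rw [hη]; nlinarith
  have hL1 : 1 ≤ -Real.log η := by
    have h1 : Real.log η ≤ Real.log (1 / 4) := Real.log_le_log hη0 hη4
    have h2 : Real.log (1 / 4) = -(2 * Real.log 2) := by
      rw [show (1 / 4 : ℝ) = (2 ^ 2)⁻¹ by norm_num, Real.log_inv, Real.log_pow]; norm_num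
    have h3 := Real.log_two_gt_d9
    linarith
  set K : ℝ := (2 + B) * lam ^ (-κ) with hK
  have hK0 : 0 ≤ K := by positivity
  have hden : ∀ p, 1 / ‖(α : ℂ) - (starRingEnd ℂ) (omegaR Θ lam p) - (η : ℂ) * Complex.I‖ ≤
      K * (1 / (|α - edisp p| + η)) := fun p =>
    den_bound hB hl0 (by linarith) hκ0 hη (hT Θ hΘ _).1 (hT Θ hΘ _).2
  set N : (Fin 3 → ℝ) → ℝ :=
    fun p => ‖(α : ℂ) - (starRingEnd ℂ) (omegaR Θ lam p) - (η : ℂ) * Complex.I‖ with hN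
  have hNe : ∀ p, ENNReal.ofReal (1 / N p) ≤ ENNReal.ofReal K * prp α η p := by
    intro p
    rw [prp, ri_eq (by positivity), ← ENNReal.ofReal_mul hK0]
    exact ENNReal.ofReal_le_ofReal (hden p)
  have hN0 : ∀ p, 0 ≤ 1 / N p := fun p => one_div_nonneg.2 (norm_nonneg _)
  have hpt : ∀ p q r : Fin 3 → ℝ, ‖1 / (N p * N q * N r * N (p - q + r - u))‖ₑ ≤
      ENNReal.ofReal (K ^ 4) * (prp α η p * prp α η q * prp α η r * prp α η (p - q + r - u)) := by
    intro p q r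
    have e : 1 / (N p * N q * N r * N (p - q + r - u)) =
        1 / N p * (1 / N q) * (1 / N r) * (1 / N (p - q + r - u)) := by
      simp only [one_div, mul_inv]
    rw [e, Real.enorm_of_nonneg (mul_nonneg (mul_nonneg (mul_nonneg (hN0 _) (hN0 _)) (hN0 _)) (hN0 _)),
      ENNReal.ofReal_mul (mul_nonneg (mul_nonneg (hN0 _) (hN0 _)) (hN0 _)),
      ENNReal.ofReal_mul (mul_nonneg (hN0 _) (hN0 _)), ENNReal.ofReal_mul (hN0 _)]
    refine (mul_le_mul' (mul_le_mul' (mul_le_mul' (hNe p) (hNe q)) (hNe r)) (hNe _)).trans (le_of_eq ?_)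
    rw [ENNReal.ofReal_pow hK0]; ring
  have hmain : ‖∫ p in T3, ∫ q in T3, ∫ r in T3, 1 / (N p * N q * N r * N (p - q + r - u))‖ₑ ≤
      ENNReal.ofReal (K ^ 4 * (C * (-Real.log η) ^ 7)) := by
    calc _ ≤ ∫⁻ p in T3, ∫⁻ q in T3, ∫⁻ r in T3, ‖1 / (N p * N q * N r * N (p - q + r - u))‖ₑ := by
          refine (enorm_integral_le_lintegral_enorm _).trans (lintegral_mono fun p => ?_)
          refine (enorm_integral_le_lintegral_enorm _).trans (lintegral_mono fun q => ?_)
          exact enorm_integral_le_lintegral_enorm _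
      _ ≤ ∫⁻ p in T3, ∫⁻ q in T3, ∫⁻ r in T3, ENNReal.ofReal (K ^ 4) *
            (prp α η p * prp α η q * prp α η r * prp α η (p - q + r - u)) :=
          lintegral_mono fun p => lintegral_mono fun q => lintegral_mono fun r => hpt p q r
      _ = ENNReal.ofReal (K ^ 4) * ∫⁻ p in T3, ∫⁻ q in T3, ∫⁻ r in T3,
            prp α η p * prp α η q * prp α η r * prp α η (p - q + r - u) := by
          simp only [lintegral_const_mul' _ _ ENNReal.ofReal_ne_top]
      _ ≤ _ := by
          rw [ENNReal.ofReal_mul (by positivity)]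
          exact mul_le_mul' le_rfl (hJ η α hη0 (by linarith) hα hΛα u)
  have hL0 : 0 ≤ -Real.log η := by linarith
  rw [← ofReal_norm, ENNReal.ofReal_le_ofReal_iff (by positivity)] at hmain
  refine (Real.le_norm_self _).trans (hmain.trans ?_)
  have hK4 : K ^ 4 = (2 + B) ^ 4 * lam ^ (-(4 * κ)) := by
    rw [hK, mul_pow, ← Real.rpow_natCast (lam ^ (-κ)), ← Real.rpow_mul hl0.le]
    congr 2; push_cast; ring
  rw [hK4, abs_of_nonpos (by linarith)]
  have hp : (-Real.log η) ^ 7 ≤ (-Real.log η) ^ 14 := pow_le_pow_right₀ hL1 (by norm_num)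
  have hq : 0 ≤ (2 + B) ^ 4 * lam ^ (-(4 * κ)) * C := by positivity
  nlinarith [mul_le_mul_of_nonneg_left hp hq]

end
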